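/- arXiv:1702.07574 — 2 statements merged into one kernel-verified Lean document; each statement's English description precedes it below -/
import Mathlib

section
/- If I ⊆ S is a squarefree monomial ideal generated in degree 2 which has a linear resolution, then after a suitable renumbering of the variables, I is weakly polymatroidal. -/
open MvPolynomial

/-- A monomial ideal: an ideal generated by monomials. -/
def IsMonomialIdeal {K : Type*} [Field K] {σ : Type*}
    (I : Ideal (MvPolynomial σ K)) : Prop :=
  ∃ G : Set (σ →₀ ℕ), I = Ideal.span ((fun a : σ →₀ ℕ => (monomial a (1 : K))) '' G)

/-- `u = x^a` is a cleaner monomial of `I`: `u` is a non-unit monomial not in `I`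
with `min(I + Su) ⊆ min(I)`. -/
def IsCleaner {K : Type*} [Field K] {σ : Type*}
    (I : Ideal (MvPolynomial σ K)) (a : σ →₀ ℕ) : Prop :=
  a ≠ 0 ∧ (monomial a (1 : K)) ∉ I ∧
    (I + Ideal.span {(monomial a (1 : K))}).minimalPrimes ⊆ I.minimalPrimes

/-- `I` has no embedded prime ideals: every associated prime of `S/I` is a minimal prime of `I`. -/
def NoEmbeddedPrimes {K : Type*} [Field K] {σ : Type*}
    (I : Ideal (MvPolynomial σ K)) : Prop :=
  ∀ P ∈ associatedPrimes (MvPolynomial σ K) (MvPolynomial σ K ⧸ I), P ∈ I.minimalPrimes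

/-- `I` is `k`-clean: `I` is prime, or `I` has no embedded primes and there is a cleaner
monomial `u ∉ I` with `|supp u| ≤ k+1` such that `I : u` and `I + Su` are `k`-clean. -/
inductive KClean (K : Type*) [Field K] (σ : Type*) (k : ℕ) :
    Ideal (MvPolynomial σ K) → Prop
  | prime (I : Ideal (MvPolynomial σ K)) (h : I.IsPrime) : KClean K σ k I
  | step (I : Ideal (MvPolynomial σ K)) (a : σ →₀ ℕ)
      (hne : NoEmbeddedPrimes I) (hcl : IsCleaner I a)
      (hsupp : a.support.card ≤ k + 1)
      (hcolon : KClean K σ k (Submodule.colon I (Ideal.span {(monomial a (1 : K))})))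
      (hsum : KClean K σ k (I + Ideal.span {(monomial a (1 : K))})) : KClean K σ k I

/-- A submodule of `S/I` is multigraded iff it is generated by images of monomials. -/
def IsMultigradedSubmodule {K : Type*} [Field K] {σ : Type*}
    (I : Ideal (MvPolynomial σ K)) (N : Submodule (MvPolynomial σ K) (MvPolynomial σ K ⧸ I)) :
    Prop :=
  ∃ A : Set (σ →₀ ℕ),
    N = Submodule.span (MvPolynomial σ K)
      ((fun a : σ →₀ ℕ => Ideal.Quotient.mk I (monomial a (1 : K))) '' A)

/-- `I` is clean: `S/I` admits a multigraded prime filtration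
`0 = M₀ ⊂ M₁ ⊂ ⋯ ⊂ M_r = S/I` whose factors `M_i/M_{i-1}` are isomorphic to `S/P_i`
(with a multidegree shift) for minimal primes `P_i` of `I`. -/
def IsClean {K : Type*} [Field K] {σ : Type*} (I : Ideal (MvPolynomial σ K)) : Prop :=
  ∃ (r : ℕ) (M : Fin (r + 1) → Submodule (MvPolynomial σ K) (MvPolynomial σ K ⧸ I)),
    M 0 = ⊥ ∧ M (Fin.last r) = ⊤ ∧ StrictMono M ∧
    (∀ i, IsMultigradedSubmodule I (M i)) ∧
    (∀ i : Fin r, ∃ P ∈ I.minimalPrimes,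
      Nonempty ((↥(M i.succ) ⧸ (Submodule.comap (M i.succ).subtype (M i.castSucc)))
        ≃ₗ[MvPolynomial σ K] (MvPolynomial σ K ⧸ P)))

/-- A finite graded free resolution of `S/I` over `S = K[x₁,…,xₙ]`:
`⋯ → F₁ → F₀ → S/I → 0`, where `Fᵢ` is free with basis elements of (twisted) degrees
`dg i j`, the differentials are given by matrices of homogeneous entries respecting the
degrees, the augmentation sends the `j`-th basis vector of `F₀` to the class of the
homogeneous polynomial `gen j`, and only finitely many `Fᵢ` are nonzero. -/
structure GradedFreeResolution (K : Type*) [Field K] (n : ℕ)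
    (I : Ideal (MvPolynomial (Fin n) K)) where
  rank : ℕ → ℕ
  dg : (i : ℕ) → Fin (rank i) → ℕ
  mat : (i : ℕ) → Matrix (Fin (rank i)) (Fin (rank (i + 1))) (MvPolynomial (Fin n) K)
  gen : Fin (rank 0) → MvPolynomial (Fin n) K
  finite : ∃ N : ℕ, ∀ i : ℕ, N < i → rank i = 0
  gen_hom : ∀ j, (gen j).IsHomogeneous (dg 0 j)
  mat_hom : ∀ i k l, mat i k l = 0 ∨
    ∃ c : ℕ, (mat i k l).IsHomogeneous c ∧ dg (i + 1) l = dg i k + c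
  aug_surj : Function.Surjective
    (fun v : Fin (rank 0) → MvPolynomial (Fin n) K =>
      Ideal.Quotient.mk I (∑ j, v j * gen j))
  exact_zero : Function.Exact (fun w => (mat 0).mulVec w)
    (fun v : Fin (rank 0) → MvPolynomial (Fin n) K =>
      Ideal.Quotient.mk I (∑ j, v j * gen j))
  exact_succ : ∀ i : ℕ, Function.Exact
    (fun w => (mat (i + 1)).mulVec w) (fun w => (mat i).mulVec w)

/-- The set of exponents of the minimal monomial generators `G(I)` of a monomial ideal. -/
def minGens {K : Type*} [Field K] {σ : Type*} (I : Ideal (MvPolynomial σ K)) :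
    Set (σ →₀ ℕ) :=
  {a | (monomial a (1 : K)) ∈ I ∧
    ∀ b : σ →₀ ℕ, (monomial b (1 : K)) ∈ I → b ≤ a → b = a}

/-- `I` is weakly polymatroidal (with respect to the variable order
`x₀ > x₁ > ⋯ > x_{n-1}`): for all monomials `u = x^a >_lex v = x^b` in `G(I)` with
`a_s = b_s` for `s < t` and `a_t > b_t`, there is `j > t` with `x_t·(v/x_j) ∈ I`. -/
def WeaklyPolymatroidal {K : Type*} [Field K] {n : ℕ}
    (I : Ideal (MvPolynomial (Fin n) K)) : Prop :=
  ∀ a ∈ minGens I, ∀ b ∈ minGens I, ∀ t : Fin n,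
    (∀ s : Fin n, s < t → a s = b s) → b t < a t →
    ∃ j : Fin n, t < j ∧ 1 ≤ b j ∧
      (monomial (b + Finsupp.single t 1 - Finsupp.single j 1) (1 : K)) ∈ I

/-- `I`, generated in degree 2, has a linear resolution: `S/I` has a graded free
resolution with `F₀` generated in degree 0 and `F_{i+1}` generated in degree `i + 2`. -/
def HasLinearResolutionDegTwo {K : Type*} [Field K] {n : ℕ}
    (I : Ideal (MvPolynomial (Fin n) K)) : Prop :=
  ∃ F : GradedFreeResolution K n I,
    (∀ j : Fin (F.rank 0), F.dg 0 j = 0) ∧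
    ∀ (i : ℕ) (j : Fin (F.rank (i + 1))), F.dg (i + 1) j = i + 2


section KoszulAux

/-- Koszul sign. -/
noncomputable def ksg (K : Type*) [Field K] {n : ℕ} (v : Fin n) (G : Finset (Fin n)) :
    MvPolynomial (Fin n) K :=
  (-1) ^ (G.filter (· < v)).card

/-- Koszul differential on families indexed by finite sets. -/
noncomputable def kos (K : Type*) [Field K] {n : ℕ} {M : Type*} [AddCommGroup M]
    [Module (MvPolynomial (Fin n) K) M] (c : Finset (Fin n) → M) (G : Finset (Fin n)) : M :=
  ∑ v ∈ Gᶜ, (ksg K v G * X v) • c (insert v G)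

variable {K : Type*} [Field K] {n : ℕ}

theorem ksg_sq (v : Fin n) (G : Finset (Fin n)) : ksg K v G * ksg K v G = 1 := by
  unfold ksg
  rw [← mul_pow]; simp

theorem ksg_insert_lt {u v : Fin n} {G : Finset (Fin n)} (hv : v ∉ G) (h : v < u) :
    ksg K u (insert v G) = - ksg K u G := by
  unfold ksg
  rw [Finset.filter_insert, if_pos h, Finset.card_insert_of_notMem (by simp [hv]), pow_succ]
  ring

theorem ksg_insert_gt {u v : Fin n} {G : Finset (Fin n)} (h : u < v) :
    ksg K u (insert v G) = ksg K u G := by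
  unfold ksg
  rw [Finset.filter_insert, if_neg (by exact not_lt.mpr h.le)]

theorem ksg_swap {u v : Fin n} {G : Finset (Fin n)} (huv : u ≠ v) (hu : u ∉ G) (hv : v ∉ G) :
    ksg K u (insert v G) * ksg K v (insert u G) = - (ksg K u G * ksg K v G) := by
  rcases lt_or_gt_of_ne huv with h | h
  · rw [ksg_insert_gt h, ksg_insert_lt hu h]; ring
  · rw [ksg_insert_gt h, ksg_insert_lt hv h]; ring

theorem ksg_swap' {u v : Fin n} {G : Finset (Fin n)} (huv : u ≠ v) (hu : u ∉ G) (hv : v ∉ G) :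
    ksg K u G * ksg K v (insert u G) = - (ksg K v G * ksg K u (insert v G)) := by
  rcases lt_or_gt_of_ne huv with h | h
  · rw [ksg_insert_gt h, ksg_insert_lt hu h]; ring
  · rw [ksg_insert_gt h, ksg_insert_lt hv h]; ring

section Mod
variable {M N : Type*} [AddCommGroup M] [Module (MvPolynomial (Fin n) K) M]
  [AddCommGroup N] [Module (MvPolynomial (Fin n) K) N]

theorem kos_map (f : M →ₗ[MvPolynomial (Fin n) K] N) (c : Finset (Fin n) → M)
    (G : Finset (Fin n)) : f (kos K c G) = kos K (fun F => f (c F)) G := by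
  simp [kos, map_sum]

theorem kos_sub (c d : Finset (Fin n) → M) (G : Finset (Fin n)) :
    kos K (fun F => c F - d F) G = kos K c G - kos K d G := by
  simp [kos, smul_sub]

theorem kos_add (c d : Finset (Fin n) → M) (G : Finset (Fin n)) :
    kos K (fun F => c F + d F) G = kos K c G + kos K d G := by
  simp [kos, smul_add, Finset.sum_add_distrib]

theorem kos_kos (c : Finset (Fin n) → M) (G : Finset (Fin n)) :
    kos K (kos K c) G = 0 := by
  unfold kos
  simp only [Finset.smul_sum, smul_smul]
  rw [Finset.sum_sigma']
  refine Finset.sum_involution (fun a _ => ⟨a.2, a.1⟩) ?_ ?_ ?_ ?_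
  · rintro ⟨u, v⟩ h
    simp only [Finset.mem_sigma, Finset.mem_compl, Finset.mem_insert, not_or] at h
    obtain ⟨hu, hvu, hv⟩ := h
    dsimp only
    rw [Finset.insert_comm v u, ← add_smul]
    have := ksg_swap' (K := K) (fun h => hvu h.symm) hu hv
    have h2 : ksg K u G * X u * (ksg K v (insert u G) * X v) +
      ksg K v G * X v * (ksg K u (insert v G) * X u) = 0 := by
      linear_combination (X u * X v) * this
    rw [h2, zero_smul]
  · rintro ⟨u, v⟩ h _ heq
    simp only [Finset.mem_sigma, Finset.mem_compl, Finset.mem_insert, not_or] at h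
    simp only [Sigma.mk.injEq, heq_eq_eq] at heq
    exact h.2.1 heq.1
  · rintro ⟨u, v⟩ h
    simp only [Finset.mem_sigma, Finset.mem_compl, Finset.mem_insert, not_or] at h ⊢
    exact ⟨h.2.2, fun e => h.2.1 e.symm, h.1⟩
  · rintro ⟨u, v⟩ h; rfl
end Mod

/-- division by a variable -/
theorem divX_X_mul_ne {u v : Fin n} (h : u ≠ v) (f : MvPolynomial (Fin n) K) :
    (X u * f).divMonomial (Finsupp.single v 1) = X u * f.divMonomial (Finsupp.single v 1) := by
  ext m
  rw [coeff_divMonomial, coeff_X_mul', coeff_X_mul']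
  have : (u ∈ (Finsupp.single v 1 + m).support) ↔ u ∈ m.support := by
    simp [h.symm]
  simp only [this]
  split_ifs with hu
  · rw [coeff_divMonomial]
    congr 1
    have : 1 ≤ m u := Nat.one_le_iff_ne_zero.mpr (by simpa using hu)
    rw [add_tsub_assoc_of_le]
    simpa using this
  · rfl

theorem divX_ksg (v u : Fin n) (G : Finset (Fin n)) (f : MvPolynomial (Fin n) K) :
    (ksg K u G * f).divMonomial (Finsupp.single v 1)
      = ksg K u G * f.divMonomial (Finsupp.single v 1) := by
  unfold ksg
  rcases neg_one_pow_eq_or (MvPolynomial (Fin n) K) (G.filter (· < u)).card with h | h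
  · rw [h]; simp
  · rw [h]; ext m; simp

theorem divX_sum {ι : Type*} (v : Fin n) (s : Finset ι) (f : ι → MvPolynomial (Fin n) K) :
    (∑ i ∈ s, f i).divMonomial (Finsupp.single v 1)
      = ∑ i ∈ s, (f i).divMonomial (Finsupp.single v 1) := by
  ext m; simp [coeff_divMonomial, coeff_sum]

/-- One step of the contracting homotopy. -/
theorem kos_step (v : Fin n) (c : Finset (Fin n) → MvPolynomial (Fin n) K)
    (hc : ∀ G, kos K c G = 0) :
    ∃ b : Finset (Fin n) → MvPolynomial (Fin n) K, ∀ G,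
      kos K b G = c G - if v ∈ G then 0 else (c G).modMonomial (Finsupp.single v 1) := by
  refine ⟨fun F => if v ∈ F then
    ksg K v (F.erase v) * (c (F.erase v)).divMonomial (Finsupp.single v 1) else 0, fun G => ?_⟩
  by_cases hv : v ∈ G
  · rw [if_pos hv, sub_zero]
    obtain ⟨G', hG', rfl⟩ : ∃ G', v ∉ G' ∧ G = insert v G' :=
      ⟨G.erase v, by simp, by simp [hv]⟩
    have h1 := congrArg (fun p => p.divMonomial (Finsupp.single v 1)) (hc G')
    simp only [kos] at h1
    have hcomp : G'ᶜ = insert v ((insert v G')ᶜ) := by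
      ext w; simp only [Finset.mem_compl, Finset.mem_insert, not_or]
      constructor
      · intro h; by_cases e : w = v
        · exact Or.inl e
        · exact Or.inr ⟨e, h⟩
      · rintro (rfl | h)
        · exact hG'
        · exact h.2
    rw [hcomp] at h1
    have h2 : c (insert v G') = - ksg K v G' * ∑ u ∈ (insert v G')ᶜ,
        ksg K u G' * (X u * (c (insert u G')).divMonomial (Finsupp.single v 1)) := by
      rw [divX_sum, Finset.sum_insert (by simp)] at h1
      simp only [smul_eq_mul, mul_assoc, divX_ksg] at h1
      rw [X_mul_divMonomial] at h1
      have h3 : ∀ u ∈ (insert v G')ᶜ, ksg K u G' *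
          (X u * c (insert u G')).divMonomial (Finsupp.single v 1) =
          ksg K u G' * (X u * (c (insert u G')).divMonomial (Finsupp.single v 1)) := by
        intro u hu
        rw [divX_X_mul_ne]
        rintro rfl; simp at hu
      rw [Finset.sum_congr rfl h3] at h1
      have h0 : (0 : MvPolynomial (Fin n) K).divMonomial (Finsupp.single v 1) = 0 := by
        ext m; simp
      rw [h0] at h1
      linear_combination ksg K v G' * h1 - c (insert v G') * ksg_sq (K := K) v G'
    rw [h2, Finset.mul_sum]
    unfold kos
    refine Finset.sum_congr rfl fun u hu => ?_
    simp only [Finset.mem_compl, Finset.mem_insert, not_or] at hu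
    have he : (insert u (insert v G')).erase v = insert u G' := by
      rw [Finset.insert_comm, Finset.erase_insert]
      simp only [Finset.mem_insert, not_or]; exact ⟨fun e => hu.1 e.symm, hG'⟩
    dsimp only
    rw [if_pos (by simp), he, smul_eq_mul]
    linear_combination (X u * (c (insert u G')).divMonomial (Finsupp.single v 1)) *
      ksg_swap (K := K) hu.1 hu.2 hG'
  · rw [if_neg hv]
    unfold kos
    rw [Finset.sum_eq_single_of_mem v (by simpa using hv)]
    · dsimp only
      rw [if_pos (by simp), Finset.erase_insert hv, smul_eq_mul]
      have := divMonomial_add_modMonomial_single (c G) v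
      linear_combination (X v * (c G).divMonomial (Finsupp.single v 1)) *
        ksg_sq (K := K) v G + this
    · intro u hu huv
      dsimp only
      rw [if_neg, smul_zero]
      simp only [Finset.mem_insert, not_or]; exact ⟨fun e => huv e.symm, hv⟩

theorem kos_exact_aux (T : Finset (Fin n)) (c : Finset (Fin n) → MvPolynomial (Fin n) K)
    (hc : ∀ G, kos K c G = 0) (h0 : coeff 0 (c ∅) = 0) :
    ∃ b d : Finset (Fin n) → MvPolynomial (Fin n) K,
      (∀ G, c G = kos K b G + d G) ∧ coeff 0 (d ∅) = 0 ∧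
      (∀ v ∈ T, ∀ G, v ∈ G → d G = 0) ∧
      (∀ v ∈ T, ∀ G m, m v ≠ 0 → coeff m (d G) = 0) := by
  induction T using Finset.induction_on with
  | empty => exact ⟨fun _ => 0, c, fun G => by simp [kos], h0, by simp, by simp⟩
  | insert v T hv ih =>
    obtain ⟨b, d, h1, h2, h3, h4⟩ := ih
    have hd : ∀ G, kos K d G = 0 := by
      intro G
      have : d = fun F => c F - kos K b F := by
        funext F; rw [h1 F]; ring
      rw [this, kos_sub, hc, kos_kos, sub_zero]
    obtain ⟨b', hb'⟩ := kos_step v d hd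
    have hmod : ∀ G m, coeff m ((d G).modMonomial (Finsupp.single v 1)) =
        if m v = 0 then coeff m (d G) else 0 := by
      intro G m
      split_ifs with h
      · rw [coeff_modMonomial_of_not_le]
        intro hle; have := hle v; simp at this; omega
      · rw [coeff_modMonomial_of_le]
        rw [Finsupp.single_le_iff]; omega
    refine ⟨fun F => b F + b' F, fun G => if v ∈ G then 0 else
      (d G).modMonomial (Finsupp.single v 1), fun G => ?_, ?_, ?_, ?_⟩
    · rw [kos_add, hb', h1]; ring
    · simp [hmod, h2]
    · intro u hu G hG
      dsimp only
      split_ifs with h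
      · rfl
      · rcases Finset.mem_insert.mp hu with rfl | hu
        · exact absurd hG h
        · ext m; rw [hmod, h3 u hu G hG]; simp
    · intro u hu G m hm
      dsimp only
      split_ifs with h
      · simp
      · rw [hmod]
        rcases Finset.mem_insert.mp hu with rfl | hu
        · rw [if_neg hm]
        · rw [h4 u hu G m hm]; simp

theorem kos_exact (c : Finset (Fin n) → MvPolynomial (Fin n) K)
    (hc : ∀ G, kos K c G = 0) (h0 : coeff 0 (c ∅) = 0) :
    ∃ b : Finset (Fin n) → MvPolynomial (Fin n) K, ∀ G, c G = kos K b G := by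
  obtain ⟨b, d, h1, h2, h3, h4⟩ := kos_exact_aux Finset.univ c hc h0
  refine ⟨b, fun G => ?_⟩
  rw [h1 G]
  suffices d G = 0 by rw [this, add_zero]
  rcases G.eq_empty_or_nonempty with rfl | ⟨v, hv⟩
  · ext m
    by_cases hm : m = 0
    · rw [hm, h2]; simp
    · obtain ⟨v, hv⟩ := Finsupp.ne_iff.mp hm
      rw [h4 v (Finset.mem_univ _) _ m (by simpa using hv)]; simp
  · exact h3 v (Finset.mem_univ _) G hv

theorem kos_exact_vec {r : ℕ} (c : Finset (Fin n) → Fin r → MvPolynomial (Fin n) K)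
    (hc : ∀ G, kos K c G = 0) (h0 : ∀ l, coeff 0 (c ∅ l) = 0) :
    ∃ b : Finset (Fin n) → Fin r → MvPolynomial (Fin n) K, ∀ G, c G = kos K b G := by
  have h : ∀ l, ∃ b : Finset (Fin n) → MvPolynomial (Fin n) K, ∀ G, c G l = kos K b G := by
    intro l
    refine kos_exact (fun F => c F l) (fun G => ?_) (h0 l)
    have := kos_map (LinearMap.proj (R := MvPolynomial (Fin n) K)
      (φ := fun _ : Fin r => MvPolynomial (Fin n) K) l) c G
    rw [hc] at this
    simpa using this.symm
  choose b hb using h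
  refine ⟨fun F l => b l F, fun G => ?_⟩
  funext l
  rw [hb]
  exact (kos_map (LinearMap.proj (R := MvPolynomial (Fin n) K)
      (φ := fun _ : Fin r => MvPolynomial (Fin n) K) l) (fun F l => b l F) G).symm

end KoszulAux

section ResolutionAux

variable {K : Type*} [Field K] {n : ℕ}

/-- If all entries of `A` are homogeneous of degree `d` and `A w` has no part of degree `d`,
then the constant part of `w` can be removed. -/
theorem truncate_lift {r s d : ℕ} (A : Matrix (Fin r) (Fin s) (MvPolynomial (Fin n) K))
    (hA : ∀ k l, (A k l).IsHomogeneous d) (w : Fin s → MvPolynomial (Fin n) K)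
    (hw : ∀ k m, Finsupp.degree m = d → coeff m (A.mulVec w k) = 0) :
    A.mulVec (fun l => w l - C (coeff 0 (w l))) = A.mulVec w := by
  have h : A.mulVec (fun l => C (coeff 0 (w l))) = 0 := by
    funext k
    ext m
    simp only [Pi.zero_apply, coeff_zero]
    by_cases hm : Finsupp.degree m = d
    · rw [← hw k m hm]
      simp only [Matrix.mulVec, dotProduct, coeff_sum]
      refine Finset.sum_congr rfl fun l _ => ?_
      rw [mul_comm, coeff_C_mul, mul_comm, coeff_mul, Finset.sum_eq_single (m, 0)]
      · rintro ⟨a, b⟩ hab hne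
        rw [Finset.HasAntidiagonal.mem_antidiagonal] at hab
        dsimp only at hab ⊢
        have : coeff a (A k l) = 0 := by
          apply (hA k l).coeff_eq_zero
          intro hd
          apply hne
          have hb : b = 0 := by
            have : Finsupp.degree a + Finsupp.degree b = Finsupp.degree m := by
              rw [← hab]; exact (map_add Finsupp.degree a b).symm
            exact (Finsupp.degree_eq_zero_iff b).mp (by omega)
          subst hb
          simp at hab; rw [hab]
        rw [this, zero_mul]
      · intro h; simp at h
    · simp only [Matrix.mulVec, dotProduct, coeff_sum]
      refine Finset.sum_eq_zero fun l _ => ?_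
      rw [mul_comm, coeff_C_mul, mul_comm, (hA k l).coeff_eq_zero hm, zero_mul]
  have h2 : (fun l => w l - C (coeff 0 (w l))) = w - fun l => C (coeff 0 (w l)) := rfl
  rw [h2, Matrix.mulVec_sub, h, sub_zero]

theorem coeff_kos_vec {r : ℕ} (d : ℕ) (y : Finset (Fin n) → Fin r → MvPolynomial (Fin n) K)
    (hy : ∀ F l m, Finsupp.degree m = d → coeff m (y F l) = 0) (G : Finset (Fin n)) (l : Fin r)
    (m : Fin n →₀ ℕ) (hm : Finsupp.degree m = d + 1) : coeff m (kos K y G l) = 0 := by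
  unfold kos
  rw [Finset.sum_apply, coeff_sum]
  refine Finset.sum_eq_zero fun v _ => ?_
  rw [Pi.smul_apply, smul_eq_mul, mul_comm (ksg K v G), mul_assoc, mul_left_comm]
  have hX : ∀ p : MvPolynomial (Fin n) K, (∀ m, Finsupp.degree m = d → coeff m p = 0) →
      coeff m (X v * p) = 0 := by
    intro p hp
    rw [coeff_X_mul']
    split_ifs with h
    · apply hp
      have hle : Finsupp.single v 1 ≤ m := by
        rw [Finsupp.single_le_iff]
        exact Nat.one_le_iff_ne_zero.mpr (by simpa using h)
      have : Finsupp.degree (m - Finsupp.single v 1) + Finsupp.degree (Finsupp.single v 1)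
          = Finsupp.degree m := by
        rw [← map_add, tsub_add_cancel_of_le hle]
      rw [Finsupp.degree_single] at this
      omega
    · rfl
  unfold ksg
  rcases neg_one_pow_eq_or (MvPolynomial (Fin n) K) (G.filter (· < v)).card with h | h
  · rw [h, one_mul]; exact hX _ (fun m hm => hy _ _ m hm)
  · rw [h, neg_one_mul, coeff_neg, hX _ (fun m hm => hy _ _ m hm), neg_zero]

theorem coeff_zero_mulVec {r s d : ℕ} (hd : d ≠ 0)
    (A : Matrix (Fin r) (Fin s) (MvPolynomial (Fin n) K))
    (hA : ∀ k l, (A k l).IsHomogeneous d) (w : Fin s → MvPolynomial (Fin n) K) (k : Fin r) :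
    coeff 0 (A.mulVec w k) = 0 := by
  simp only [Matrix.mulVec, dotProduct, coeff_sum]
  refine Finset.sum_eq_zero fun l _ => ?_
  have : coeff 0 (A k l) = 0 := (hA k l).coeff_eq_zero (by simpa using hd.symm)
  rw [← constantCoeff_eq] at this ⊢
  rw [map_mul, this, zero_mul]

variable {I : Ideal (MvPolynomial (Fin n) K)}

theorem kos_mulVec {r s : ℕ} (A : Matrix (Fin r) (Fin s) (MvPolynomial (Fin n) K))
    (w : Finset (Fin n) → Fin s → MvPolynomial (Fin n) K) (G : Finset (Fin n)) :
    A.mulVec (kos K w G) = kos K (fun F => A.mulVec (w F)) G :=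
  kos_map A.mulVecLin w G

/-- one diagram chase step -/
theorem chase_step {r0 r1 r2 : ℕ} {d : ℕ} (hd : d ≠ 0)
    (A : Matrix (Fin r0) (Fin r1) (MvPolynomial (Fin n) K))
    (B : Matrix (Fin r1) (Fin r2) (MvPolynomial (Fin n) K))
    (hA : ∀ k l, (A k l).IsHomogeneous d)
    (hAB : ∀ w, A.mulVec (B.mulVec w) = 0)
    (claim : ∀ y : Finset (Fin n) → Fin r1 → MvPolynomial (Fin n) K,
      (∀ F l, coeff 0 (y F l) = 0) → (∀ G, A.mulVec (kos K y G) = 0) →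
      ∃ (b : Finset (Fin n) → Fin r1 → MvPolynomial (Fin n) K)
        (w : Finset (Fin n) → Fin r2 → MvPolynomial (Fin n) K),
        ∀ F, y F = kos K b F + B.mulVec (w F))
    (y : Finset (Fin n) → Fin r0 → MvPolynomial (Fin n) K)
    (hy0 : ∀ F l, coeff 0 (y F l) = 0)
    (hy : ∀ G k m, Finsupp.degree m = d → coeff m (kos K y G k) = 0)
    (hlift : ∀ G, ∃ w, A.mulVec w = kos K y G) :
    ∃ (b : Finset (Fin n) → Fin r0 → MvPolynomial (Fin n) K)
      (w : Finset (Fin n) → Fin r1 → MvPolynomial (Fin n) K),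
      ∀ F, y F = kos K b F + A.mulVec (w F) := by
  choose y1 hy1 using hlift
  have ht : ∀ G, A.mulVec (fun l => y1 G l - C (coeff 0 (y1 G l))) = kos K y G := by
    intro G
    rw [truncate_lift A hA _ (by rw [hy1]; exact hy G), hy1]
  obtain ⟨b', w', h'⟩ := claim (fun G l => y1 G l - C (coeff 0 (y1 G l)))
    (fun F l => by simp) (fun G => by
      rw [kos_mulVec]
      simp only [ht]
      exact kos_kos y G)
  have hker : ∀ G, kos K (fun F => y F - A.mulVec (b' F)) G = 0 := by
    intro G
    rw [kos_sub, ← ht G, h' G, Matrix.mulVec_add, hAB, ← kos_mulVec]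
    simp
  obtain ⟨b, hb⟩ := kos_exact_vec _ hker (fun l => by
    rw [Pi.sub_apply, coeff_sub, hy0, coeff_zero_mulVec hd A hA, sub_zero])
  exact ⟨b, b', fun F => by rw [← hb F]; simp⟩

theorem chase_claim (F : GradedFreeResolution K n I)
    (h1 : ∀ (i : ℕ) (j : Fin (F.rank (i + 1))), F.dg (i + 1) j = i + 2) (N : ℕ)
    (hN : ∀ i : ℕ, N < i → F.rank i = 0) (k : ℕ) :
    ∀ p, N ≤ p + k → ∀ y : Finset (Fin n) → Fin (F.rank (p + 1)) → MvPolynomial (Fin n) K,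
      (∀ G l, coeff 0 (y G l) = 0) → (∀ G, (F.mat p).mulVec (kos K y G) = 0) →
      ∃ (b : Finset (Fin n) → Fin (F.rank (p + 1)) → MvPolynomial (Fin n) K)
        (w : Finset (Fin n) → Fin (F.rank (p + 1 + 1)) → MvPolynomial (Fin n) K),
        ∀ G, y G = kos K b G + (F.mat (p + 1)).mulVec (w G) := by
  have hom : ∀ p k l, (F.mat (p + 1) k l).IsHomogeneous 1 := by
    intro p k l
    rcases F.mat_hom (p + 1) k l with h | ⟨c, hc, hd⟩
    · rw [h]; exact isHomogeneous_zero _ _ _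
    · rw [h1, h1] at hd
      obtain rfl : c = 1 := by omega
      exact hc
  induction k with
  | zero =>
    intro p hp y _ _
    have h0 := hN (p + 1) (by omega)
    refine ⟨y, fun _ => 0, fun G => ?_⟩
    funext l
    exact absurd l.2 (by omega)
  | succ k ih =>
    intro p hp y hy0 hy
    refine chase_step one_ne_zero (F.mat (p + 1)) (F.mat (p + 2)) (hom p) ?_
      (ih (p + 1) (by omega)) y hy0 ?_ ?_
    · intro w
      exact (F.exact_succ (p + 1)).apply_apply_eq_zero w
    · intro G l m hm
      refine coeff_kos_vec 0 y (fun F l m hm => ?_) G l m hm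
      rw [(Finsupp.degree_eq_zero_iff m).mp hm, hy0]
    · intro G
      exact (F.exact_succ p (kos K y G)).mp (hy G)

theorem linear_koszul (hlin : HasLinearResolutionDegTwo I)
    (z : Finset (Fin n) → MvPolynomial (Fin n) K)
    (hz : ∀ F m, Finsupp.degree m < 2 → ∀ r : MvPolynomial (Fin n) K, coeff m (r * z F) = 0)
    (hcyc : ∀ G, kos K z G ∈ I) :
    ∃ c : Finset (Fin n) → MvPolynomial (Fin n) K, ∀ G, z G - kos K c G ∈ I := by
  obtain ⟨F, h0, h1⟩ := hlin
  obtain ⟨N, hN⟩ := F.finite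
  have hom : ∀ k l, (F.mat 0 k l).IsHomogeneous 2 := by
    intro k l
    rcases F.mat_hom 0 k l with h | ⟨c, hc, hd⟩
    · rw [h]; exact isHomogeneous_zero _ _ _
    · rw [h1, h0] at hd
      obtain rfl : c = 2 := by omega
      exact hc
  let L : (Fin (F.rank 0) → MvPolynomial (Fin n) K) →ₗ[MvPolynomial (Fin n) K]
      MvPolynomial (Fin n) K := Fintype.linearCombination (MvPolynomial (Fin n) K) F.gen
  have hL : ∀ v, L v = ∑ j, v j * F.gen j := fun v => by
    simp [L, Fintype.linearCombination_apply]
  obtain ⟨r, hr⟩ := F.aug_surj (Ideal.Quotient.mk I 1)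
  have hr' : L r - 1 ∈ I := by
    rw [hL]; exact Ideal.Quotient.eq.mp hr
  have hker : ∀ v, L v ∈ I ↔ ∃ w, (F.mat 0).mulVec w = v := by
    intro v
    rw [hL, ← Ideal.Quotient.eq_zero_iff_mem]
    exact F.exact_zero v
  have hkz : ∀ G, L (kos K (fun F => z F • r) G) = kos K z G * L r := by
    intro G
    rw [kos_map]
    simp only [map_smul, smul_eq_mul, kos, Finset.sum_mul, mul_assoc]
  obtain ⟨b, w, hbw⟩ := chase_step two_ne_zero (F.mat 0) (F.mat 1) hom
    (fun w => (F.exact_succ 0).apply_apply_eq_zero w)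
    (chase_claim F h1 N hN N 0 (by omega)) (fun F => z F • r)
    (fun F l => by
      rw [Pi.smul_apply, smul_eq_mul, mul_comm]
      exact hz _ _ (by simp) _)
    (fun G k m hm => coeff_kos_vec 1 _ (fun F l m hm => by
      rw [Pi.smul_apply, smul_eq_mul, mul_comm]
      exact hz _ _ (by omega) _) G k m hm)
    (fun G => by
      rw [← hker, hkz]
      exact I.mul_mem_right _ (hcyc G))
  refine ⟨fun G => L (b G), fun G => ?_⟩
  have h2 := congrArg L (hbw G)
  rw [map_add, kos_map, map_smul, smul_eq_mul] at h2
  have h3 : L ((F.mat 0).mulVec (w G)) ∈ I := (hker _).mpr ⟨_, rfl⟩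
  have h4 : z G - kos K (fun G => L (b G)) G
      = L ((F.mat 0).mulVec (w G)) - z G * (L r - 1) := by
    linear_combination h2
  rw [h4]
  exact I.sub_mem h3 (I.mul_mem_left _ hr')

end ResolutionAux

section Dirac

variable {V K : Type*} [DecidableEq V]

/-- Obstruction property equivalent to chordality. -/
def CycProp (K : Type*) (R : V → V → Prop) : Prop :=
  ∀ p q, R p q → ∀ W : Finset V, p ∈ W → q ∈ W →
    (∀ c ∈ W, c ≠ p → c ≠ q → ¬ (R c p ∧ R c q)) →
    ∃ g : V → K, g p ≠ g q ∧ ∀ a ∈ W, ∀ b ∈ W, R a b → ({a, b} : Finset V) ≠ {p, q} → g a = g b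

/-- Simplicial vertex of an induced subgraph. -/
def SimplicialIn (R : V → V → Prop) (U : Finset V) (v : V) : Prop :=
  ∀ a ∈ U, ∀ b ∈ U, a ≠ b → R v a → R v b → R a b

theorem dirac_aux (R : V → V → Prop) (hs : ∀ a b, R a b → R b a) (hirr : ∀ a, ¬ R a a)
    (hP : CycProp K R) (U : Finset V) :
    ∀ u ∈ U, (∃ w ∈ U, w ≠ u ∧ ¬ R u w) →
      ∃ v ∈ U, v ≠ u ∧ ¬ R u v ∧ SimplicialIn R U v := by
  classical
  induction U using Finset.strongInduction with
  | H U ih =>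
  rintro u hu ⟨w, hwU, hwu, hRw⟩
  set D := U.filter (fun x => x ≠ u ∧ ¬ R u x) with hD
  have memD : ∀ x, x ∈ D ↔ x ∈ U ∧ x ≠ u ∧ ¬ R u x := by intro x; simp [hD]
  set C := D.filter (fun x => Relation.ReflTransGen (fun a b => a ∈ D ∧ b ∈ D ∧ R a b) w x)
    with hC
  have memC : ∀ x, x ∈ C ↔ x ∈ D ∧
      Relation.ReflTransGen (fun a b => a ∈ D ∧ b ∈ D ∧ R a b) w x := by intro x; simp [hC]
  set S := U.filter (fun x => x ∉ C ∧ ∃ c ∈ C, R c x) with hS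
  have memS : ∀ x, x ∈ S ↔ x ∈ U ∧ x ∉ C ∧ ∃ c ∈ C, R c x := by intro x; simp [hS]
  have hwD : w ∈ D := (memD w).mpr ⟨hwU, hwu, hRw⟩
  have hwC : w ∈ C := (memC w).mpr ⟨hwD, Relation.ReflTransGen.refl⟩
  have hCu : ∀ c ∈ C, c ∈ U ∧ c ≠ u ∧ ¬ R u c := fun c hc => (memD c).mp ((memC c).mp hc).1
  have hSu : ∀ s ∈ S, s ≠ u ∧ R u s := by
    intro s hsS
    obtain ⟨h1, h2, c, hc, hcs⟩ := (memS s).mp hsS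
    have hne : s ≠ u := by
      rintro rfl
      exact (hCu c hc).2.2 (hs _ _ hcs)
    refine ⟨hne, ?_⟩
    by_contra hn
    have hsD : s ∈ D := (memD s).mpr ⟨h1, hne, hn⟩
    exact h2 ((memC s).mpr ⟨hsD, ((memC c).mp hc).2.tail ⟨((memC c).mp hc).1, hsD, hcs⟩⟩)
  have hne_pair : ∀ a b x y : V, x ≠ a → x ≠ b → ({a, b} : Finset V) ≠ {x, y} := by
    intro a b x y h1 h2 h
    have : x ∈ ({a, b} : Finset V) := by rw [h]; simp
    simp at this; tauto
  have hclique : ∀ s ∈ S, ∀ t ∈ S, s ≠ t → R s t := by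
    intro s hsS t htS hst
    by_contra hn
    obtain ⟨hsne, hus⟩ := hSu s hsS
    obtain ⟨htne, hut⟩ := hSu t htS
    obtain ⟨g, hg1, hg2⟩ := hP u s hus (insert u (insert s (insert t C))) (by simp) (by simp) (by
      intro c hc hcu hcs
      simp only [Finset.mem_insert] at hc
      rcases hc with h | h | h | h
      · exact absurd h hcu
      · exact absurd h hcs
      · rw [h]; rintro ⟨-, h2⟩; exact hn (hs _ _ h2)
      · rintro ⟨h1, -⟩; exact (hCu c h).2.2 (hs _ _ h1))
    have hconst : ∀ c ∈ C, g c = g w := by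
      intro c hc
      have := ((memC c).mp hc).2
      clear hc
      induction this with
      | refl => rfl
      | @tail a b hab h ih =>
        have ha : a ∈ C := (memC a).mpr ⟨h.1, hab⟩
        have hb : b ∈ C := (memC b).mpr ⟨h.2.1, hab.tail h⟩
        rw [← ih]
        exact (hg2 a (by simp [ha]) b (by simp [hb]) h.2.2
          (hne_pair _ _ _ _ (hCu a ha).2.1.symm (hCu b hb).2.1.symm)).symm
    obtain ⟨-, -, c1, hc1, hR1⟩ := (memS s).mp hsS
    obtain ⟨-, -, c2, hc2, hR2⟩ := (memS t).mp htS
    have e1 : g u = g t := hg2 u (by simp) t (by simp) hut (by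
      rw [Finset.pair_comm u s]; exact hne_pair _ _ _ _ hsne hst)
    have e2 : g c2 = g t := hg2 c2 (by simp [hc2]) t (by simp) hR2
      (hne_pair _ _ _ _ (hCu c2 hc2).2.1.symm htne.symm)
    have e3 : g c1 = g s := hg2 c1 (by simp [hc1]) s (by simp) hR1
      (hne_pair _ _ _ _ (hCu c1 hc1).2.1.symm hsne.symm)
    apply hg1
    rw [e1, ← e2, ← e3, hconst c1 hc1, hconst c2 hc2]
  have hsub : C ∪ S ⊂ U := by
    refine (Finset.ssubset_iff_of_subset ?_).mpr ⟨u, hu, ?_⟩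
    · intro x hx
      rcases Finset.mem_union.mp hx with h | h
      · exact (hCu x h).1
      · exact ((memS x).mp h).1
    · intro hx
      rcases Finset.mem_union.mp hx with h | h
      · exact (hCu u h).2.1 rfl
      · exact (hSu u h).1 rfl
  suffices h : ∃ c ∈ C, SimplicialIn R (C ∪ S) c by
    obtain ⟨c, hc, hsimp⟩ := h
    have hnb : ∀ x ∈ U, R c x → x ∈ C ∪ S := by
      intro x hx hcx
      by_cases hxC : x ∈ C
      · exact Finset.mem_union_left _ hxC
      · exact Finset.mem_union_right _ ((memS x).mpr ⟨hx, hxC, c, hc, hcx⟩)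
    exact ⟨c, (hCu c hc).1, (hCu c hc).2.1, (hCu c hc).2.2,
      fun a ha b hb hab h1 h2 => hsimp a (hnb a ha h1) b (hnb b hb h2) hab h1 h2⟩
  by_cases hA : ∃ s ∈ S, ∃ x ∈ C ∪ S, x ≠ s ∧ ¬ R s x
  · obtain ⟨s, hsS, hx⟩ := hA
    obtain ⟨v, hv, hvs, hRv, hsimp⟩ := ih _ hsub s (Finset.mem_union_right _ hsS) hx
    refine ⟨v, ?_, hsimp⟩
    rcases Finset.mem_union.mp hv with h | h
    · exact h
    · exact absurd (hclique s hsS v h hvs.symm) hRv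
  · push Not at hA
    by_cases hB : ∃ c ∈ C, ∃ x ∈ C ∪ S, x ≠ c ∧ ¬ R c x
    · obtain ⟨c, hc, hx⟩ := hB
      obtain ⟨v, hv, hvs, hRv, hsimp⟩ := ih _ hsub c (Finset.mem_union_left _ hc) hx
      refine ⟨v, ?_, hsimp⟩
      rcases Finset.mem_union.mp hv with h | h
      · exact h
      · exact absurd (hs _ _ (hA v h c (Finset.mem_union_left _ hc) hvs.symm)) hRv
    · push Not at hB
      refine ⟨w, hwC, fun a ha b hb hab _ _ => ?_⟩
      rcases Finset.mem_union.mp ha with h | h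
      · exact hB a h b hb hab.symm
      · exact hA a h b hb hab.symm

theorem exists_simplicial (R : V → V → Prop) (hs : ∀ a b, R a b → R b a) (hirr : ∀ a, ¬ R a a)
    (hP : CycProp K R) (U : Finset V) (hU : U.Nonempty) : ∃ v ∈ U, SimplicialIn R U v := by
  by_cases h : ∃ u ∈ U, ∃ w ∈ U, w ≠ u ∧ ¬ R u w
  · obtain ⟨u, hu, hw⟩ := h
    obtain ⟨v, hv, -, -, h⟩ := dirac_aux R hs hirr hP U u hu hw
    exact ⟨v, hv, h⟩
  · push Not at h
    obtain ⟨v, hv⟩ := hU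
    exact ⟨v, hv, fun a ha b hb hab _ _ => h a ha b hb hab.symm⟩

theorem exists_peo (R : V → V → Prop) (hs : ∀ a b, R a b → R b a) (hirr : ∀ a, ¬ R a a)
    (hP : CycProp K R) (U : Finset V) : ∃ f : V → ℕ, Set.InjOn f U ∧
      ∀ t ∈ U, ∀ a ∈ U, ∀ b ∈ U, a ≠ b → f t < f a → f t < f b → R t a → R t b → R a b := by
  induction U using Finset.strongInduction with
  | H U ih =>
  rcases U.eq_empty_or_nonempty with rfl | hU
  · exact ⟨fun _ => 0, by simp, by simp⟩
  obtain ⟨v, hv, hsimp⟩ := exists_simplicial R hs hirr hP U hU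
  obtain ⟨f, hf1, hf2⟩ := ih (U.erase v) (Finset.erase_ssubset hv)
  refine ⟨fun w => if w = v then 0 else f w + 1, ?_, ?_⟩
  · intro a ha b hb hab
    dsimp only at hab
    split_ifs at hab with h1 h2 h2
    · rw [h1, h2]
    · exact hf1 (by simpa [h1] using ha) (by simpa [h2] using hb) (by omega)
  · intro t ht a ha b hb hab hta htb h1 h2
    dsimp only at hta htb
    have hav : a ≠ v := by rintro rfl; simp at hta
    have hbv : b ≠ v := by rintro rfl; simp at htb
    rw [if_neg hav] at hta
    rw [if_neg hbv] at htb
    by_cases htv : t = v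
    · subst htv
      exact hsimp a ha b hb hab h1 h2
    · rw [if_neg htv] at hta htb
      exact hf2 t (by simp [htv, ht]) a (by simp [hav, ha]) b (by simp [hbv, hb]) hab
        (by omega) (by omega) h1 h2

end Dirac

section Final

variable {K : Type*} [Field K] {n : ℕ}

theorem mem_sqfree_iff (G : Set (Finset (Fin n))) (f : MvPolynomial (Fin n) K) :
    f ∈ Ideal.span ((fun F : Finset (Fin n) => ∏ i ∈ F, (X i : MvPolynomial (Fin n) K)) '' G) ↔
      ∀ m ∈ f.support, ∃ F ∈ G, ∀ i ∈ F, m i ≠ 0 := by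
  have h : (fun F : Finset (Fin n) => ∏ i ∈ F, (X i : MvPolynomial (Fin n) K)) '' G =
      (fun s => monomial s (1 : K)) ''
        ((fun F : Finset (Fin n) => ∑ i ∈ F, Finsupp.single i 1) '' G) := by
    rw [Set.image_image]
    refine Set.image_congr fun F _ => ?_
    rw [monomial_sum_one]
    rfl
  rw [h, mem_ideal_span_monomial_image]
  have h2 : ∀ (F : Finset (Fin n)) (m : Fin n →₀ ℕ),
      (∑ i ∈ F, Finsupp.single i 1 ≤ m) ↔ ∀ i ∈ F, m i ≠ 0 := by
    intro F m
    have h3 : ∀ j, (∑ i ∈ F, Finsupp.single i 1 : Fin n →₀ ℕ) j = if j ∈ F then 1 else 0 := by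
      intro j
      rw [Finsupp.finsetSum_apply]
      simp [Finsupp.single_apply]
    constructor
    · intro hle i hi
      have := hle i
      rw [h3, if_pos hi] at this
      omega
    · intro hi j
      rw [h3]
      split_ifs with hj
      · exact Nat.one_le_iff_ne_zero.mpr (hi j hj)
      · exact Nat.zero_le _
  simp only [Set.exists_mem_image, h2]

theorem monomial_mem_sqfree_iff (G : Set (Finset (Fin n))) (m : Fin n →₀ ℕ) :
    (monomial m (1 : K)) ∈
      Ideal.span ((fun F : Finset (Fin n) => ∏ i ∈ F, (X i : MvPolynomial (Fin n) K)) '' G) ↔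
      ∃ F ∈ G, ∀ i ∈ F, m i ≠ 0 := by
  classical
  rw [mem_sqfree_iff, support_monomial, if_neg one_ne_zero]
  simp

theorem coeff_X_mul_low (d : ℕ) (v : Fin n) (p : MvPolynomial (Fin n) K)
    (hp : ∀ m, Finsupp.degree m < d → coeff m p = 0) (m : Fin n →₀ ℕ)
    (hm : Finsupp.degree m < d + 1) : coeff m (X v * p) = 0 := by
  rw [coeff_X_mul']
  split_ifs with h
  · apply hp
    have hle : Finsupp.single v 1 ≤ m := by
      rw [Finsupp.single_le_iff]
      exact Nat.one_le_iff_ne_zero.mpr (by simpa using h)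
    have : Finsupp.degree (m - Finsupp.single v 1) + Finsupp.degree (Finsupp.single v 1)
        = Finsupp.degree m := by
      rw [← map_add, tsub_add_cancel_of_le hle]
    rw [Finsupp.degree_single] at this
    omega
  · rfl

/-- scalar Koszul sign -/
def ssg (K : Type*) [Field K] {n : ℕ} (v : Fin n) (G : Finset (Fin n)) : K :=
  (-1) ^ (G.filter (· < v)).card

theorem ksg_eq (v : Fin n) (G : Finset (Fin n)) : ksg K v G = C (ssg K v G) := by
  simp [ksg, ssg]

theorem ssg_sq (v : Fin n) (G : Finset (Fin n)) : ssg K v G * ssg K v G = 1 := by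
  unfold ssg
  rw [← mul_pow]; simp

/-- The relevant coefficient of a Koszul boundary. -/
theorem coeff_kos_pair (c : Finset (Fin n) → MvPolynomial (Fin n) K) (W : Finset (Fin n))
    {a b : Fin n} (ha : a ∈ W) (hb : b ∈ W) (hab : a < b) :
    coeff (Finsupp.single a 1 + Finsupp.single b 1) (kos K c (W \ {a, b})) =
      ssg K a W * ssg K b W *
        (ssg K b W * coeff (Finsupp.single b 1) (c (W.erase b)) -
          ssg K a W * coeff (Finsupp.single a 1) (c (W.erase a))) := by
  have hne : a ≠ b := hab.ne
  have hins1 : insert a (W \ {a, b}) = W.erase b := by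
    ext x; simp only [Finset.mem_insert, Finset.mem_sdiff, Finset.mem_erase,
      Finset.mem_singleton]; grind
  have hins2 : insert b (W \ {a, b}) = W.erase a := by
    ext x; simp only [Finset.mem_insert, Finset.mem_sdiff, Finset.mem_erase,
      Finset.mem_singleton]; grind
  have hs1 : ssg K a (W \ {a, b}) = ssg K a W := by
    unfold ssg
    congr 2
    ext x; simp only [Finset.mem_filter, Finset.mem_insert, Finset.mem_sdiff,
      Finset.mem_singleton]; grind
  have hs2 : ssg K b (W \ {a, b}) = - ssg K b W := by
    unfold ssg
    have : W.filter (· < b) = insert a ((W \ {a, b}).filter (· < b)) := by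
      ext x; simp only [Finset.mem_filter, Finset.mem_insert, Finset.mem_sdiff,
        Finset.mem_singleton]; grind
    rw [this, Finset.card_insert_of_notMem (by simp), pow_succ]
    ring
  unfold kos
  rw [coeff_sum, ← Finset.sum_subset (s₁ := {a, b})]
  · rw [Finset.sum_pair hne, hins1, hins2]
    simp only [smul_eq_mul, mul_assoc, ksg_eq, coeff_C_mul]
    rw [coeff_X_mul, add_comm (Finsupp.single a 1), coeff_X_mul, hs1, hs2]
    linear_combination (-ssg K a W * coeff (Finsupp.single b 1) (c (W.erase b))) *
      ssg_sq (K := K) b W + (ssg K b W * coeff (Finsupp.single a 1) (c (W.erase a))) *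
      ssg_sq (K := K) a W
  · intro x hx
    simp only [Finset.mem_insert, Finset.mem_singleton] at hx
    simp; tauto
  · intro x _ hx
    simp only [smul_eq_mul, mul_assoc, ksg_eq, coeff_C_mul]
    rw [coeff_X_mul', if_neg, mul_zero]
    simp only [Finset.mem_insert, Finset.mem_singleton, not_or] at hx
    simp [Finsupp.single_apply, Ne.symm hx.1, Ne.symm hx.2]

/-- A linear resolution forces the complementary graph to be chordal. -/
theorem cycProp_of_linear
    (I : Ideal (MvPolynomial (Fin n) K)) (G : Set (Finset (Fin n)))
    (hdeg : ∀ F ∈ G, F.card = 2)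
    (hI : I = Ideal.span ((fun F : Finset (Fin n) =>
      ∏ i ∈ F, (X i : MvPolynomial (Fin n) K)) '' G))
    (hlin : HasLinearResolutionDegTwo I) :
    CycProp K (fun a b : Fin n => a ≠ b ∧ ({a, b} : Finset (Fin n)) ∉ G) := by
  rintro p q ⟨hpq, hpqG⟩ W hpW hqW hcom
  obtain ⟨c, hc⟩ := linear_koszul hlin (fun F => if F = W \ {p, q} then X p * X q else 0)
    (by
      intro F m hm r
      split_ifs
      · rw [mul_comm, mul_assoc]
        refine coeff_X_mul_low 1 p _ (fun m hm => coeff_X_mul_low 0 q _ ?_ m hm) m hm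
        intro m hm; omega
      · simp)
    (by
      intro E
      unfold kos
      refine Ideal.sum_mem _ fun v hv => ?_
      rw [smul_eq_mul]
      dsimp only
      split_ifs with h
      · have hvW : v ∈ W \ {p, q} := by rw [← h]; simp
        simp only [Finset.mem_sdiff, Finset.mem_insert, Finset.mem_singleton, not_or] at hvW
        have hor : ({v, p} : Finset (Fin n)) ∈ G ∨ ({v, q} : Finset (Fin n)) ∈ G := by
          have := hcom v hvW.1 hvW.2.1 hvW.2.2
          have h1 := hvW.2.1
          have h2 := hvW.2.2
          tauto
        rcases hor with h | h
        · have : (X v * X p : MvPolynomial (Fin n) K) ∈ I := by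
            rw [hI]
            refine Ideal.subset_span ⟨_, h, ?_⟩
            exact Finset.prod_pair hvW.2.1
          have h2 : ksg K v E * X v * (X p * X q) = ksg K v E * X q * (X v * X p) := by ring
          rw [h2]
          exact I.mul_mem_left _ this
        · have : (X v * X q : MvPolynomial (Fin n) K) ∈ I := by
            rw [hI]
            refine Ideal.subset_span ⟨_, h, ?_⟩
            exact Finset.prod_pair hvW.2.2
          have h2 : ksg K v E * X v * (X p * X q) = ksg K v E * X p * (X v * X q) := by ring
          rw [h2]
          exact I.mul_mem_left _ this
      · rw [mul_zero]; exact I.zero_mem)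
  have key : ∀ a ∈ W, ∀ b ∈ W, a < b → ({a, b} : Finset (Fin n)) ∉ G →
      coeff (Finsupp.single a 1 + Finsupp.single b 1)
        (if W \ {a, b} = W \ {p, q} then (X p * X q : MvPolynomial (Fin n) K) else 0) =
      ssg K a W * ssg K b W *
        (ssg K b W * coeff (Finsupp.single b 1) (c (W.erase b)) -
          ssg K a W * coeff (Finsupp.single a 1) (c (W.erase a))) := by
    intro a ha b hb hab hG
    rw [← coeff_kos_pair c W ha hb hab, ← sub_eq_zero, ← coeff_sub]
    have h1 := hc (W \ {a, b})
    rw [hI, mem_sqfree_iff] at h1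
    by_contra hne
    obtain ⟨F, hF, hF2⟩ := h1 _ (mem_support_iff.mpr hne)
    apply hG
    have hsub : F ⊆ {a, b} := by
      intro i hi
      have := hF2 i hi
      simp only [Finsupp.add_apply, Finsupp.single_apply] at this
      simp only [Finset.mem_insert, Finset.mem_singleton]
      grind
    rw [← Finset.eq_of_subset_of_card_le hsub (by
      rw [hdeg F hF]; exact Finset.card_le_two)]
    exact hF
  have hpair : ∀ a ∈ W, ∀ b ∈ W, W \ {a, b} = W \ {p, q} → a ≠ b →
      ({a, b} : Finset (Fin n)) = {p, q} := by
    intro a ha b hb h hab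
    have h1 : ∀ x ∈ W, x ∈ ({a, b} : Finset (Fin n)) ↔ x ∈ ({p, q} : Finset (Fin n)) := by
      intro x hx
      have := congrArg (fun s => x ∈ s) h
      simp only [Finset.mem_sdiff, hx, true_and, eq_iff_iff] at this
      tauto
    ext x
    constructor
    · intro hx
      refine (h1 x ?_).mp hx
      simp at hx; rcases hx with rfl | rfl <;> assumption
    · intro hx
      refine (h1 x ?_).mpr hx
      simp at hx; rcases hx with rfl | rfl <;> assumption
  have hss : ∀ v, ssg K v W ≠ 0 := fun v h => by
    have := ssg_sq (K := K) v W
    rw [h] at this; simp at this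
  refine ⟨fun v => ssg K v W * coeff (Finsupp.single v 1) (c (W.erase v)), ?_, ?_⟩
  · have main : ∀ a b : Fin n, a < b → ({a, b} : Finset (Fin n)) = {p, q} → a ∈ W → b ∈ W →
        ({a, b} : Finset (Fin n)) ∉ G → (X a * X b : MvPolynomial (Fin n) K) = X p * X q →
        ssg K a W * coeff (Finsupp.single a 1) (c (W.erase a)) ≠
        ssg K b W * coeff (Finsupp.single b 1) (c (W.erase b)) := by
      intro a b hab he ha hb hG hX heq
      have := key a ha b hb hab hG
      rw [if_pos (by rw [he]), ← hX, heq, sub_self, mul_zero, coeff_X_mul, coeff_X] at this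
      simp at this
    rcases lt_or_gt_of_ne hpq with h | h
    · exact main p q h rfl hpW hqW hpqG rfl
    · exact (main q p h (Finset.pair_comm _ _) hqW hpW (by rwa [Finset.pair_comm])
        (mul_comm _ _)).symm
  · have main : ∀ a ∈ W, ∀ b ∈ W, a < b → ({a, b} : Finset (Fin n)) ∉ G →
        ({a, b} : Finset (Fin n)) ≠ {p, q} →
        ssg K a W * coeff (Finsupp.single a 1) (c (W.erase a)) =
        ssg K b W * coeff (Finsupp.single b 1) (c (W.erase b)) := by
      intro a ha b hb hab hG hne
      have := key a ha b hb hab hG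
      rw [if_neg (fun h => hne (hpair a ha b hb h hab.ne)), coeff_zero] at this
      have h2 := (mul_eq_zero.mp this.symm).resolve_left (mul_ne_zero (hss a) (hss b))
      exact (sub_eq_zero.mp h2).symm
    rintro a ha b hb ⟨hab, hG⟩ hne
    rcases lt_or_gt_of_ne hab with h | h
    · exact main a ha b hb h hG hne
    · exact (main b hb a ha h (by rwa [Finset.pair_comm]) (by rwa [Finset.pair_comm])).symm

/-- A perfect elimination order of the complement gives weak polymatroidality. -/
theorem wp_of_peo (G : Set (Finset (Fin n))) (hdeg : ∀ F ∈ G, F.card = 2)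
    (hpeo : ∀ t a b : Fin n, t < a → a < b → ({a, b} : Finset (Fin n)) ∈ G →
      ({t, a} : Finset (Fin n)) ∈ G ∨ ({t, b} : Finset (Fin n)) ∈ G) :
    WeaklyPolymatroidal (Ideal.span ((fun F : Finset (Fin n) =>
      ∏ i ∈ F, (X i : MvPolynomial (Fin n) K)) '' G)) := by
  have hgen : ∀ a ∈ minGens (Ideal.span ((fun F : Finset (Fin n) =>
      ∏ i ∈ F, (X i : MvPolynomial (Fin n) K)) '' G)), ∃ p q : Fin n, p < q ∧
      ({p, q} : Finset (Fin n)) ∈ G ∧ ∀ x, a x = if x = p ∨ x = q then 1 else 0 := by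
    rintro a ⟨ha, hmin⟩
    obtain ⟨F, hF, hF2⟩ := (monomial_mem_sqfree_iff G a).mp ha
    obtain ⟨p, q, hpq, hFpq⟩ : ∃ p q : Fin n, p < q ∧ F = {p, q} := by
      obtain ⟨x, y, hxy, h⟩ := Finset.card_eq_two.mp (hdeg F hF)
      rcases lt_or_gt_of_ne hxy with h1 | h1
      · exact ⟨x, y, h1, h⟩
      · exact ⟨y, x, h1, by rw [h, Finset.pair_comm]⟩
    subst hFpq
    have hp := hF2 p (by simp)
    have hq := hF2 q (by simp)
    have hval : ∀ x, (Finsupp.single p 1 + Finsupp.single q 1 : Fin n →₀ ℕ) x =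
        if x = p ∨ x = q then 1 else 0 := by
      intro x
      simp only [Finsupp.add_apply, Finsupp.single_apply]
      grind
    refine ⟨p, q, hpq, hF, ?_⟩
    rw [← hmin (Finsupp.single p 1 + Finsupp.single q 1) ?_ ?_]
    · exact hval
    · refine (monomial_mem_sqfree_iff G _).mpr ⟨_, hF, ?_⟩
      intro i hi
      rw [hval]
      simp at hi
      simp [hi]
    · intro x
      rw [hval]
      split_ifs with h
      · rcases h with rfl | rfl <;> omega
      · omega
  intro a ha b hb t hlt ht
  obtain ⟨r, s, hrs, hrsG, hav⟩ := hgen a ha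
  obtain ⟨p, q, hpq, hpqG, hbv⟩ := hgen b hb
  have hfin : ∀ x j : Fin n, ({t, x} : Finset (Fin n)) ∈ G → x ≠ j → t ≠ j → 1 ≤ b x →
      (monomial (b + Finsupp.single t 1 - Finsupp.single j 1) (1 : K)) ∈
        Ideal.span ((fun F : Finset (Fin n) =>
          ∏ i ∈ F, (X i : MvPolynomial (Fin n) K)) '' G) := by
    intro x j hG hxj htj hbx
    refine (monomial_mem_sqfree_iff G _).mpr ⟨_, hG, ?_⟩
    intro i hi
    simp only [Finset.mem_insert, Finset.mem_singleton] at hi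
    simp only [Finsupp.tsub_apply, Finsupp.add_apply, Finsupp.single_apply]
    rcases hi with rfl | rfl
    · rw [if_pos rfl, if_neg (Ne.symm htj)]; omega
    · rw [if_neg (Ne.symm hxj)]; omega
  have hat : t = r ∨ t = s := by
    by_contra h; rw [hav t, if_neg h] at ht; omega
  have hbt : t ≠ p ∧ t ≠ q := by
    rw [hav t, if_pos hat, hbv t] at ht
    constructor <;> (rintro rfl; simp at ht)
  have hbp : b p = 1 := by rw [hbv]; simp
  have hbq : b q = 1 := by rw [hbv]; simp
  have hap : p < t → p = r ∨ p = s := by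
    intro h
    by_contra hn
    have := hlt p h
    rw [hav, if_neg hn, hbp] at this; omega
  have haq : q < t → q = r ∨ q = s := by
    intro h
    by_contra hn
    have := hlt q h
    rw [hav, if_neg hn, hbq] at this; omega
  rcases hat with rfl | rfl
  · have htp : t < p := by
      rcases lt_trichotomy t p with h | h | h
      · exact h
      · exact absurd h hbt.1
      · rcases hap h with h1 | h1
        · exact absurd h1.symm hbt.1
        · rw [h1] at h; exact absurd (h.trans hrs) (lt_irrefl _)
    have htq : t < q := htp.trans hpq
    rcases hpeo t p q htp hpq hpqG with h | h
    · exact ⟨q, htq, hbq.ge, hfin p q h hpq.ne htq.ne hbp.ge⟩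
    · exact ⟨p, htp, hbp.ge, hfin q p h hpq.ne' htp.ne hbq.ge⟩
  · have hr : r = p ∨ r = q := by
      by_contra hn
      have := hlt r hrs
      rw [hav, hbv, if_neg hn] at this; simp at this
    have hqt : t < q := by
      rcases lt_trichotomy t q with h | h | h
      · exact h
      · exact absurd h hbt.2
      · exfalso
        have h1 := hap (hpq.trans h)
        have h2 := haq h
        have h3 := hbt
        grind
    have hrp : r = p := by
      rcases hr with h | h
      · exact h
      · rw [h] at hrs; exact absurd (hrs.trans hqt) (lt_irrefl _)
    subst hrp
    exact ⟨q, hqt, hbq.ge, hfin r q (by rwa [Finset.pair_comm]) hpq.ne hqt.ne hbp.ge⟩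

end Final

/-- If `I` is a squarefree monomial ideal generated in degree 2 which has
a linear resolution, then after a suitable renumbering of the variables `I` is weakly
polymatroidal. -/
theorem linear_resolution_weakly_polymatroidal {K : Type*} [Field K] {n : ℕ}
    (I : Ideal (MvPolynomial (Fin n) K)) (G : Set (Finset (Fin n)))
    (hdeg : ∀ F ∈ G, F.card = 2)
    (hI : I = Ideal.span ((fun F : Finset (Fin n) =>
      ∏ i ∈ F, (X i : MvPolynomial (Fin n) K)) '' G))
    (hlin : HasLinearResolutionDegTwo I) :
    ∃ e : Equiv.Perm (Fin n),
      WeaklyPolymatroidal (Ideal.map (rename e : MvPolynomial (Fin n) K →ₐ[K] _) I) := by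
  have hs : ∀ a b : Fin n, (a ≠ b ∧ ({a, b} : Finset (Fin n)) ∉ G) →
      (b ≠ a ∧ ({b, a} : Finset (Fin n)) ∉ G) := fun a b h =>
    ⟨h.1.symm, by rw [Finset.pair_comm]; exact h.2⟩
  obtain ⟨f, hinj, hf⟩ := exists_peo _ hs (fun a h => h.1 rfl)
    (cycProp_of_linear I G hdeg hI hlin) Finset.univ
  have hinj' : Function.Injective f := fun a b h => hinj (by simp) (by simp) h
  have hmono : StrictMono (f ∘ Tuple.sort f) :=
    (Tuple.monotone_sort f).strictMono_of_injective (hinj'.comp (Tuple.sort f).injective)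
  refine ⟨(Tuple.sort f).symm, ?_⟩
  set σ := Tuple.sort f with hσ
  have hmap : Ideal.map (rename σ.symm : MvPolynomial (Fin n) K →ₐ[K] MvPolynomial (Fin n) K) I =
      Ideal.span ((fun F : Finset (Fin n) =>
        ∏ i ∈ F, (X i : MvPolynomial (Fin n) K)) '' {F | F.image σ ∈ G}) := by
    rw [hI, Ideal.map_span, Set.image_image]
    congr 1
    ext y
    simp only [Set.mem_image, Set.mem_setOf_eq]
    constructor
    · rintro ⟨F, hF, rfl⟩
      refine ⟨F.image σ.symm, ?_, ?_⟩
      · rw [Finset.image_image]; simpa using hF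
      · rw [Finset.prod_image (fun a _ b _ h => σ.symm.injective h), map_prod]
        simp
    · rintro ⟨F, hF, rfl⟩
      refine ⟨_, hF, ?_⟩
      rw [Finset.prod_image (fun a _ b _ h => σ.injective h), map_prod]
      simp
  rw [hmap]
  refine wp_of_peo _ ?_ ?_
  · intro F hF
    rw [← hdeg _ hF, Finset.card_image_of_injective _ σ.injective]
  · intro t a b hta hab hG
    simp only [Set.mem_setOf_eq, Finset.image_insert, Finset.image_singleton] at hG ⊢
    by_contra hn
    rw [not_or] at hn
    exact (hf (σ t) (by simp) (σ a) (by simp) (σ b) (by simp)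
      (fun h => hab.ne (σ.injective h)) (hmono hta) (hmono (hta.trans hab))
      ⟨fun h => hta.ne (σ.injective h), hn.1⟩
      ⟨fun h => (hta.trans hab).ne (σ.injective h), hn.2⟩).2 hG
end

section
/- Let I ⊆ S be a monomial ideal such that S/I is Cohen–Macaulay and I has codimension (height) 2. Then I is 0-clean. -/
open MvPolynomial

/-- The depth of `S/I` with respect to the irrelevant maximal ideal
`m = (x₁,…,xₙ)`: the supremum of the lengths of regular sequences on `S/I`
consisting of elements of `m`. -/
noncomputable def depthQuot {K : Type*} [Field K] {n : ℕ}
    (I : Ideal (MvPolynomial (Fin n) K)) : ℕ :=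
  sSup {r : ℕ | ∃ rs : List (MvPolynomial (Fin n) K), rs.length = r ∧
    (∀ x ∈ rs, x ∈ Ideal.span (Set.range (X : Fin n → MvPolynomial (Fin n) K))) ∧
    RingTheory.Sequence.IsRegular (MvPolynomial (Fin n) K ⧸ I) rs}

/-- `S/I` is Cohen–Macaulay: its depth equals its Krull dimension. -/
def IsCohenMacaulayQuot {K : Type*} [Field K] {n : ℕ}
    (I : Ideal (MvPolynomial (Fin n) K)) : Prop :=
  (depthQuot I : WithBot ℕ∞) = ringKrullDim (MvPolynomial (Fin n) K ⧸ I)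

/-- Ideal generated by the monomials with exponents in `G`. -/
noncomputable def mI (K : Type*) [Field K] {σ : Type*} (G : Set (σ →₀ ℕ)) :
    Ideal (MvPolynomial σ K) :=
  Ideal.span ((fun a : σ →₀ ℕ => (monomial a (1 : K))) '' G)

section partTwo

variable {K : Type*} [Field K] {n : ℕ}

lemma mem_mI {σ : Type*} {G : Set (σ →₀ ℕ)} {p : MvPolynomial σ K} :
    p ∈ mI K G ↔ ∀ d ∈ p.support, ∃ m ∈ G, m ≤ d :=
  mem_ideal_span_monomial_image

lemma monomial_mem_mI {σ : Type*} {G : Set (σ →₀ ℕ)} {d : σ →₀ ℕ} :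
    monomial d (1 : K) ∈ mI K G ↔ ∃ m ∈ G, m ≤ d := by
  classical
  rw [mem_mI, support_monomial, if_neg one_ne_zero]
  simp

lemma mI_le {σ : Type*} {G H : Set (σ →₀ ℕ)} (h : ∀ g ∈ G, ∃ m ∈ H, m ≤ g) :
    mI K G ≤ mI K H := by
  intro p hp
  rw [mem_mI] at *
  intro d hd
  obtain ⟨g, hg, hgd⟩ := hp d hd
  obtain ⟨m, hm, hmg⟩ := h g hg
  exact ⟨m, hm, hmg.trans hgd⟩

lemma mI_colon {σ : Type*} (G : Set (σ →₀ ℕ)) (u : σ →₀ ℕ) :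
    Submodule.colon (mI K G) (Ideal.span {(monomial u (1 : K))} : Set (MvPolynomial σ K))
      = mI K ((fun m => m - u) '' G) := by
  classical
  ext p
  have h1 : p ∈ Submodule.colon (mI K G) (Ideal.span {(monomial u (1 : K))} :
      Set (MvPolynomial σ K)) ↔ p * monomial u 1 ∈ mI K G := by
    rw [Submodule.mem_colon]
    constructor
    · intro h
      exact h _ (Ideal.subset_span rfl)
    · intro h s hs
      obtain ⟨t, rfl⟩ := Ideal.mem_span_singleton'.1 hs
      have := (mI K G).mul_mem_left t h
      rw [smul_eq_mul]
      convert this using 1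
      ring
  rw [h1, mem_mI, mem_mI]
  constructor
  · intro h d hd
    obtain ⟨m, hm, hmd⟩ := h (d + u) (by
      rw [mem_support_iff] at hd ⊢
      rwa [coeff_mul_monomial, mul_one])
    exact ⟨m - u, ⟨m, hm, rfl⟩, tsub_le_iff_right.2 hmd⟩
  · intro h d hd
    rw [mem_support_iff, coeff_mul_monomial'] at hd
    split_ifs at hd with hud
    · obtain ⟨_, ⟨m, hm, rfl⟩, hmd⟩ := h (d - u) (by
        rw [mem_support_iff]; simpa using hd)
      refine ⟨m, hm, ?_⟩
      have := tsub_le_iff_right.1 hmd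
      rwa [tsub_add_cancel_of_le hud] at this
    · exact absurd rfl hd

lemma mI_add {σ : Type*} (G : Set (σ →₀ ℕ)) (u : σ →₀ ℕ) :
    mI K G + Ideal.span {(monomial u (1 : K))} = mI K (insert u G) := by
  rw [mI, mI, Set.image_insert_eq, Ideal.span_insert, add_comm]
  rfl

/-- Good: clean, and all associated primes are generated by two variables. -/
def Good (I : Ideal (MvPolynomial (Fin n) K)) : Prop :=
  KClean K (Fin n) 0 I ∧
    ∀ P ∈ associatedPrimes (MvPolynomial (Fin n) K) (MvPolynomial (Fin n) K ⧸ I),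
      ∃ i j : Fin n, i ≠ j ∧ P = Ideal.span {X i, X j}

lemma var_of_monomial_mem {σ : Type*} {Q : Ideal (MvPolynomial σ K)} [hQ : Q.IsPrime] {d : σ →₀ ℕ}
    (h : monomial d (1 : K) ∈ Q) : ∃ l, d l ≠ 0 ∧ X l ∈ Q := by
  rw [monomial_eq, C_1, one_mul, Finsupp.prod, hQ.prod_mem_iff] at h
  obtain ⟨l, hl, h⟩ := h
  exact ⟨l, Finsupp.mem_support_iff.1 hl, hQ.mem_of_pow_mem _ h⟩

lemma X_mem_span_pair {i j l : Fin n}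
    (h : (X l : MvPolynomial (Fin n) K) ∈ Ideal.span {X i, X j}) : l = i ∨ l = j := by
  have : (X l : MvPolynomial (Fin n) K) ∈ Ideal.span (X '' {i, j}) := by
    rwa [Set.image_pair]
  rw [mem_ideal_span_X_image] at this
  obtain ⟨k, hk, hl⟩ := this (Finsupp.single l 1) (by simp [X, support_monomial])
  have : l = k := by
    by_contra hne
    exact hl (by simp [Finsupp.single_apply, hne])
  subst this
  simpa using hk

lemma minimal_of_pair {I : Ideal (MvPolynomial (Fin n) K)}
    (hg : ∀ i : Fin n, ∃ d : Fin n →₀ ℕ, d i = 0 ∧ monomial d (1 : K) ∈ I)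
    {P : Ideal (MvPolynomial (Fin n) K)} (hP : P.IsPrime) (hIP : I ≤ P) {i j : Fin n}
    (h : P = Ideal.span {X i, X j}) : P ∈ I.minimalPrimes := by
  refine ⟨⟨hP, hIP⟩, ?_⟩
  rintro Q ⟨hQ, hIQ⟩ hQP
  have key : ∀ i' j' : Fin n, P = Ideal.span {X i', X j'} → X j' ∈ Q := by
    intro i' j' h'
    obtain ⟨d, hd, hdI⟩ := hg i'
    obtain ⟨l, hl, hlQ⟩ := var_of_monomial_mem (Q := Q) (hIQ hdI)
    have := hQP hlQ
    rw [h'] at this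
    rcases X_mem_span_pair this with rfl | rfl
    · exact absurd hd hl
    · exact hlQ
  rw [h, Ideal.span_le]
  rintro x (rfl | rfl)
  · exact key j i (by rw [h, Set.pair_comm])
  · exact key i j h

lemma ass_union (I : Ideal (MvPolynomial (Fin n) K)) (u : MvPolynomial (Fin n) K) :
    associatedPrimes (MvPolynomial (Fin n) K) (MvPolynomial (Fin n) K ⧸ I) ⊆
    associatedPrimes (MvPolynomial (Fin n) K) (MvPolynomial (Fin n) K ⧸
      (Submodule.colon I (Ideal.span {u} : Set (MvPolynomial (Fin n) K)))) ∪
    associatedPrimes (MvPolynomial (Fin n) K) (MvPolynomial (Fin n) K ⧸ (I + Ideal.span {u})) := by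
  have hmem : ∀ p, p ∈ Submodule.colon I (Ideal.span {u} : Set (MvPolynomial (Fin n) K)) ↔
      p * u ∈ I := by
    intro p
    rw [Submodule.mem_colon]
    constructor
    · intro h
      exact h _ (Ideal.subset_span rfl)
    · intro h s hs
      obtain ⟨t, rfl⟩ := Ideal.mem_span_singleton'.1 hs
      have := I.mul_mem_left t h
      rw [smul_eq_mul]
      convert this using 1
      ring
  let f : (MvPolynomial (Fin n) K ⧸
      (Submodule.colon I (Ideal.span {u} : Set (MvPolynomial (Fin n) K)))) →ₗ[MvPolynomial (Fin n) K]
      (MvPolynomial (Fin n) K ⧸ I) :=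
    Submodule.mapQ _ _ (LinearMap.mulRight _ u) (by
      intro p hp
      exact (hmem p).1 hp)
  let g : (MvPolynomial (Fin n) K ⧸ I) →ₗ[MvPolynomial (Fin n) K]
      (MvPolynomial (Fin n) K ⧸ (I + Ideal.span {u})) :=
    Submodule.mapQ _ _ LinearMap.id (by
      intro p hp
      exact Ideal.mem_sup_left hp)
  refine associatedPrimes.subset_union_of_exact (f := f) (g := g) ?_ ?_
  · rw [← LinearMap.ker_eq_bot, LinearMap.ker_eq_bot']
    intro m hm
    obtain ⟨p, rfl⟩ := Submodule.Quotient.mk_surjective _ m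
    have h2 : (Submodule.Quotient.mk (p * u) : MvPolynomial (Fin n) K ⧸ I) = 0 := hm
    rw [Submodule.Quotient.mk_eq_zero] at h2 ⊢
    exact (hmem p).2 h2
  · intro y
    obtain ⟨p, rfl⟩ := Submodule.Quotient.mk_surjective _ y
    have : g (Submodule.Quotient.mk p) = Submodule.Quotient.mk p := rfl
    rw [this, Submodule.Quotient.mk_eq_zero]
    constructor
    · intro h
      obtain ⟨a, ha, b, hb, hab⟩ := Submodule.mem_sup.1 h
      obtain ⟨t, rfl⟩ := Ideal.mem_span_singleton'.1 hb
      refine ⟨Submodule.Quotient.mk t, ?_⟩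
      change (Submodule.Quotient.mk (t * u) : MvPolynomial (Fin n) K ⧸ I) = Submodule.Quotient.mk p
      rw [Submodule.Quotient.eq, ← hab]
      simpa using ha
    · rintro ⟨t, ht⟩
      obtain ⟨t, rfl⟩ := Submodule.Quotient.mk_surjective _ t
      change (Submodule.Quotient.mk (t * u) : MvPolynomial (Fin n) K ⧸ I) = Submodule.Quotient.mk p
        at ht
      rw [Submodule.Quotient.eq] at ht
      have : p = -(t * u - p) + t * u := by ring
      rw [this]
      exact Submodule.add_mem_sup (I.neg_mem ht) (Ideal.mem_span_singleton'.2 ⟨t, rfl⟩)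

lemma le_of_mem_ass {I P : Ideal (MvPolynomial (Fin n) K)}
    (h : P ∈ associatedPrimes (MvPolynomial (Fin n) K) (MvPolynomial (Fin n) K ⧸ I)) : I ≤ P := by
  have := IsAssociatedPrime.annihilator_le h
  rw [Submodule.annihilator_top, Ideal.annihilator_quotient] at this
  exact this

lemma good_step {I : Ideal (MvPolynomial (Fin n) K)}
    (hg : ∀ i : Fin n, ∃ d : Fin n →₀ ℕ, d i = 0 ∧ monomial d (1 : K) ∈ I)
    {j : Fin n} {a : ℕ} (ha : a ≠ 0) (hu : monomial (Finsupp.single j a) (1 : K) ∉ I)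
    (h1 : Good (Submodule.colon I
      (Ideal.span {monomial (Finsupp.single j a) (1 : K)} : Set (MvPolynomial (Fin n) K))))
    (h2 : Good (I + Ideal.span {monomial (Finsupp.single j a) (1 : K)})) : Good I := by
  have hass : ∀ P ∈ associatedPrimes (MvPolynomial (Fin n) K) (MvPolynomial (Fin n) K ⧸ I),
      ∃ i j : Fin n, i ≠ j ∧ P = Ideal.span {X i, X j} := by
    intro P hP
    rcases ass_union I _ hP with h | h
    · exact h1.2 P h
    · exact h2.2 P h
  refine ⟨KClean.step I (Finsupp.single j a) ?_ ⟨?_, hu, ?_⟩ ?_ h1.1 h2.1, hass⟩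
  · intro P hP
    obtain ⟨i, j, _, h⟩ := hass P hP
    exact minimal_of_pair hg hP.1 (le_of_mem_ass hP) h
  · simpa using ha
  · intro P hP
    have hP' : P ∈ associatedPrimes (MvPolynomial (Fin n) K) (MvPolynomial (Fin n) K ⧸
        (I + Ideal.span {monomial (Finsupp.single j a) (1 : K)})) := by
      apply Module.associatedPrimes.minimalPrimes_annihilator_subset_associatedPrimes
      rwa [Ideal.annihilator_quotient]
    obtain ⟨i, j, _, h⟩ := h2.2 P hP'
    exact minimal_of_pair hg hP.1.1 (le_sup_left.trans hP.1.2) h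
  · rw [Finsupp.support_single_ne_zero _ ha]; simp



lemma prime_span_X {σ : Type*} (s : Set σ) :
    (Ideal.span (X '' s) : Ideal (MvPolynomial σ K)).IsPrime := by
  classical
  let φ : MvPolynomial σ K →ₐ[K] MvPolynomial σ K := aeval (fun i => if i ∈ s then 0 else X i)
  have h1 : ∀ p, φ p - p ∈ Ideal.span (X '' s : Set (MvPolynomial σ K)) := by
    intro p
    induction p using MvPolynomial.induction_on with
    | C a => simp [φ]
    | add p q hp hq =>
      rw [map_add, add_sub_add_comm]
      exact Ideal.add_mem _ hp hq
    | mul_X p i hp =>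
      have hX : φ (X i) - X i ∈ Ideal.span (X '' s : Set (MvPolynomial σ K)) := by
        by_cases hi : i ∈ s
        · have : φ (X i) = 0 := by simp [φ, hi]
          rw [this, zero_sub]
          exact Ideal.neg_mem_iff _ |>.2 (Ideal.subset_span ⟨i, hi, rfl⟩)
        · simp [φ, hi]
      have : φ (p * X i) - p * X i = φ (X i) * (φ p - p) + p * (φ (X i) - X i) := by
        rw [map_mul]; ring
      rw [this]
      exact Ideal.add_mem _ (Ideal.mul_mem_left _ _ hp) (Ideal.mul_mem_left _ _ hX)
  have h2 : Ideal.span (X '' s : Set (MvPolynomial σ K)) = RingHom.ker φ := by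
    apply le_antisymm
    · rw [Ideal.span_le]
      rintro _ ⟨i, hi, rfl⟩
      simp [φ, hi]
    · intro p hp
      have := h1 p
      rw [RingHom.mem_ker] at hp
      rw [hp, zero_sub] at this
      exact Ideal.neg_mem_iff _ |>.1 this
  rw [h2]
  exact RingHom.ker_isPrime _

lemma prime_pair (i j : Fin n) :
    (Ideal.span {X i, X j} : Ideal (MvPolynomial (Fin n) K)).IsPrime := by
  rw [← Set.image_pair]
  exact prime_span_X _

lemma good_prime {i j : Fin n} (hij : i ≠ j) :
    Good (K := K) (mI K {Finsupp.single i 1, Finsupp.single j 1}) := by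
  have h : mI K {Finsupp.single i 1, Finsupp.single j 1} = Ideal.span {X i, X j} := by
    rw [mI, Set.image_pair]; rfl
  have hp := prime_pair (K := K) i j
  rw [h]
  refine ⟨KClean.prime _ hp, ?_⟩
  intro P hP
  refine ⟨i, j, hij, ?_⟩
  rw [associatedPrimes.eq_singleton_of_isPrimary hp.isPrimary] at hP
  rw [Set.mem_singleton_iff.1 hP, hp.radical]

lemma good_ci (N : ℕ) : ∀ (m : Fin n →₀ ℕ) (j : Fin n) (a : ℕ), m.degree + a ≤ N → m ≠ 0 →
    m j = 0 → a ≠ 0 → Good (K := K) (mI K {m, Finsupp.single j a}) := by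
  induction N with
  | zero => intro m j a h _ _ ha; omega
  | succ N ih =>
    intro m j a hN hm hmj ha
    have hg : ∀ i : Fin n, ∃ d : Fin n →₀ ℕ, d i = 0 ∧
        monomial d (1 : K) ∈ mI K {m, Finsupp.single j a} := by
      intro i
      by_cases hij : i = j
      · subst hij
        exact ⟨m, hmj, monomial_mem_mI.2 ⟨m, by simp, le_rfl⟩⟩
      · exact ⟨Finsupp.single j a, by simp [hij], monomial_mem_mI.2 ⟨_, by simp, le_rfl⟩⟩
    have hmdeg : m.degree ≠ 0 := by
      rwa [Ne, Finsupp.degree_eq_zero_iff]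
    by_cases ha1 : a = 1
    · subst ha1
      obtain ⟨l, hl⟩ : ∃ l, m l ≠ 0 := by
        by_contra! h
        exact hm (Finsupp.ext h)
      have hlj : l ≠ j := by rintro rfl; exact hl hmj
      have hle : Finsupp.single l 1 ≤ m := by
        rw [Finsupp.single_le_iff]; omega
      by_cases hml : m = Finsupp.single l 1
      · rw [hml]; exact good_prime hlj
      · have hnle : ¬ m ≤ Finsupp.single l 1 := fun h => hml (le_antisymm h hle)
        refine good_step (j := l) (a := 1) hg one_ne_zero ?_ ?_ ?_
        · rw [monomial_mem_mI]
          rintro ⟨_, rfl | rfl, h⟩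
          · exact hnle h
          · have := h j
            simp [hlj] at this
        · rw [mI_colon, Set.image_pair]
          have h1 : (Finsupp.single j 1 : Fin n →₀ ℕ) - Finsupp.single l 1 = Finsupp.single j 1 := by
            ext k
            by_cases hk : k = j
            · subst hk; simp [hlj]
            · simp [Finsupp.single_apply, Ne.symm hk]
          rw [h1]
          have h3 : (m - Finsupp.single l 1) + Finsupp.single l 1 = m := tsub_add_cancel_of_le hle
          refine ih _ _ _ ?_ ?_ ?_ one_ne_zero
          · have h2 : (m - Finsupp.single l 1).degree + 1 = m.degree := by
              conv_rhs => rw [← h3]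
              rw [map_add, Finsupp.degree_single]
            omega
          · intro h0
            rw [h0, zero_add] at h3
            exact hml h3.symm
          · simp [hmj]
        · rw [mI_add]
          have : mI K (insert (Finsupp.single l 1) {m, Finsupp.single j 1}) =
              mI K {Finsupp.single l 1, Finsupp.single j 1} := by
            apply le_antisymm
            · apply mI_le
              rintro g (rfl | rfl | rfl)
              · exact ⟨_, by simp, le_rfl⟩
              · exact ⟨Finsupp.single l 1, by simp, hle⟩
              · exact ⟨_, by simp, le_rfl⟩
            · apply mI_le
              rintro g (rfl | rfl)
              · exact ⟨_, by simp, le_rfl⟩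
              · exact ⟨_, by simp, le_rfl⟩
          rw [this]
          exact good_prime hlj
    · refine good_step (j := j) (a := 1) hg one_ne_zero ?_ ?_ ?_
      · rw [monomial_mem_mI]
        rintro ⟨_, rfl | rfl, h⟩
        · apply hm
          ext k
          have := h k
          by_cases hk : k = j
          · subst hk; exact hmj
          · rw [Finsupp.single_eq_of_ne hk] at this
            simpa using this
        · have := h j
          simp at this; omega
      · rw [mI_colon, Set.image_pair]
        have h1 : m - Finsupp.single j 1 = m := by
          ext k
          by_cases hk : k = j
          · subst hk; simp [hmj]
          · simp [Finsupp.single_apply, Ne.symm hk]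
        rw [h1, ← Finsupp.single_tsub]
        exact ih _ _ _ (by omega) hm hmj (by omega)
      · rw [mI_add]
        have : mI K (insert (Finsupp.single j 1) {m, Finsupp.single j a}) =
            mI K {m, Finsupp.single j 1} := by
          apply le_antisymm
          · apply mI_le
            rintro g (rfl | rfl | rfl)
            · exact ⟨_, by simp, le_rfl⟩
            · exact ⟨_, by simp, le_rfl⟩
            · refine ⟨Finsupp.single j 1, by simp, ?_⟩
              rw [Finsupp.single_le_iff]; simp; omega
          · apply mI_le
            rintro g (rfl | rfl)
            · exact ⟨_, by simp, le_rfl⟩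
            · exact ⟨_, by simp, le_rfl⟩
        rw [this]
        exact ih _ _ _ (by omega) hm hmj one_ne_zero

/-- Tree structured lists of exponents, built by adding leaves. -/
inductive Tr {σ : Type*} : List (σ →₀ ℕ) → Prop
  | single (m : σ →₀ ℕ) : Tr [m]
  | cons (v : σ →₀ ℕ) (L : List (σ →₀ ℕ)) (w : σ →₀ ℕ) (hw : w ∈ L)
      (h : ∀ i ∈ L, w ≤ v ⊔ i) (hL : Tr L) : Tr (v :: L)

lemma Tr.trunc {σ : Type*} {L : List (σ →₀ ℕ)} (h : Tr L) (u : σ →₀ ℕ) :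
    Tr (L.map (fun m => m - u)) := by
  induction h with
  | single m => exact Tr.single _
  | cons v L w hw h hL ih =>
    refine Tr.cons _ _ (w - u) (List.mem_map.2 ⟨w, hw, rfl⟩) ?_ ih
    intro i hi
    obtain ⟨i', hi', rfl⟩ := List.mem_map.1 hi
    intro k
    have := h i' hi' k
    simp only [Finsupp.sup_apply, Finsupp.tsub_apply] at this ⊢
    rcases le_sup_iff.1 this with h | h
    · exact le_sup_of_le_left (by omega)
    · exact le_sup_of_le_right (by omega)

lemma good_tr (N : ℕ) : ∀ (L : List (Fin n →₀ ℕ)), Tr L → (L.map Finsupp.degree).sum + L.length ≤ N →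
    mI K {m | m ∈ L} ≠ ⊤ → (∀ i, ∃ m ∈ L, m i = 0) → Good (K := K) (mI K {m | m ∈ L}) := by
  induction N with
  | zero =>
    intro L hL hN
    cases hL <;> simp at hN
  | succ N ih =>
    intro L hL hN htop hgcd
    have hne : ∀ m ∈ L, m ≠ 0 := by
      rintro m hm rfl
      apply htop
      rw [Ideal.eq_top_iff_one]
      exact monomial_mem_mI.2 ⟨0, hm, le_rfl⟩
    have hg : ∀ i : Fin n, ∃ d : Fin n →₀ ℕ, d i = 0 ∧
        monomial d (1 : K) ∈ mI K {m | m ∈ L} := by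
      intro i
      obtain ⟨m, hm, h⟩ := hgcd i
      exact ⟨m, h, monomial_mem_mI.2 ⟨m, hm, le_rfl⟩⟩
    cases hL with
    | single m =>
      exfalso
      apply hne m (by simp)
      ext i
      obtain ⟨m', hm', h⟩ := hgcd i
      simp at hm'
      subst hm'
      simpa using h
    | cons v L w hw h hL =>
      by_cases hwv : w ≤ v
      · have heq : mI K {m | m ∈ v :: L} = mI K {m | m ∈ L} := by
          apply le_antisymm
          · apply mI_le
            intro g hgL
            rcases List.mem_cons.1 hgL with rfl | hgL
            · exact ⟨w, hw, hwv⟩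
            · exact ⟨g, hgL, le_rfl⟩
          · apply mI_le
            intro g hgL
            exact ⟨g, List.mem_cons_of_mem _ hgL, le_rfl⟩
        rw [heq] at htop ⊢
        refine ih L hL ?_ htop ?_
        · simp at hN; omega
        · intro i
          obtain ⟨m, hm, h0⟩ := hgcd i
          rcases List.mem_cons.1 hm with rfl | hm
          · exact ⟨w, hw, by have := hwv i; omega⟩
          · exact ⟨m, hm, h0⟩
      · obtain ⟨j, hj⟩ : ∃ j, v j < w j := by
          by_contra! hc
          exact hwv hc
        have hLj : ∀ i ∈ L, w j ≤ i j := by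
          intro i hi
          have := h i hi j
          rw [Finsupp.sup_apply] at this
          rcases le_sup_iff.1 this with h | h
          · omega
          · exact h
        have hvj : v j = 0 := by
          obtain ⟨m, hm, h0⟩ := hgcd j
          rcases List.mem_cons.1 hm with rfl | hm
          · exact h0
          · have := hLj m hm; omega
        have ha : w j ≠ 0 := by omega
        have hv0 : v ≠ 0 := hne v (by simp)
        have hci := good_ci (K := K) _ v j (w j) le_rfl hv0 hvj ha
        have hsing : ∀ i ∈ L, Finsupp.single j (w j) ≤ i := by
          intro i hi
          rw [Finsupp.single_le_iff]
          exact hLj i hi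
        by_cases hu : monomial (Finsupp.single j (w j)) (1 : K) ∈ mI K {m | m ∈ v :: L}
        · have heq : mI K {m | m ∈ v :: L} = mI K {v, Finsupp.single j (w j)} := by
            obtain ⟨m, hm, hmle⟩ := monomial_mem_mI.1 hu
            apply le_antisymm
            · apply mI_le
              intro g hgL
              rcases List.mem_cons.1 hgL with rfl | hgL
              · exact ⟨g, by simp, le_rfl⟩
              · exact ⟨_, by simp, hsing g hgL⟩
            · apply mI_le
              rintro g (rfl | rfl)
              · exact ⟨g, by simp, le_rfl⟩
              · exact ⟨m, hm, hmle⟩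
          rw [heq]; exact hci
        · refine good_step hg ha hu ?_ ?_
          · have himg : (fun m => m - Finsupp.single j (w j)) '' {m | m ∈ v :: L} =
                {m | m ∈ (v :: L).map (fun m => m - Finsupp.single j (w j))} := by
              ext m; simp [eq_comm]
            rw [mI_colon, himg]
            refine ih _ ((Tr.cons v L w hw h hL).trunc _) ?_ ?_ ?_
            · have hlt : (((v :: L).map (fun m => m - Finsupp.single j (w j))).map
                  Finsupp.degree).sum < ((v :: L).map Finsupp.degree).sum := by
                rw [List.map_map]
                refine List.sum_lt_sum _ _ ?_ ⟨w, List.mem_cons_of_mem _ hw, ?_⟩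
                · intro m _
                  exact Finsupp.degree_mono tsub_le_self
                · have h3 := tsub_add_cancel_of_le (hsing w hw)
                  conv_rhs => rw [← h3]
                  rw [map_add, Finsupp.degree_single]
                  simp only [Function.comp]
                  omega
              rw [List.length_map]
              omega
            · intro ht
              rw [← himg, ← mI_colon, Submodule.colon_eq_top_iff_subset] at ht
              exact hu (ht (Ideal.subset_span rfl))
            · intro i
              obtain ⟨m, hm, h0⟩ := hgcd i
              exact ⟨_, List.mem_map.2 ⟨m, hm, rfl⟩, by simp [h0]⟩
          · rw [mI_add]
            have heq : mI K (insert (Finsupp.single j (w j)) {m | m ∈ v :: L}) =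
                mI K {v, Finsupp.single j (w j)} := by
              apply le_antisymm
              · apply mI_le
                rintro g (rfl | hgL)
                · exact ⟨_, by simp, le_rfl⟩
                · rcases List.mem_cons.1 hgL with rfl | hgL
                  · exact ⟨g, by simp, le_rfl⟩
                  · exact ⟨_, by simp, hsing g hgL⟩
              · apply mI_le
                rintro g (rfl | rfl)
                · exact ⟨g, by simp, le_rfl⟩
                · exact ⟨_, by simp, le_rfl⟩
            rw [heq]; exact hci

end partTwo

section comb

variable {K : Type*} [Field K]

lemma touch {ι : Type*} {A : Set (ι × ι)} {i j : ι} (hij : i ≠ j)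
    (h : (Finsupp.single i 1 - Finsupp.single j 1 : ι →₀ K) ∈ Submodule.span K
      ((fun e : ι × ι => (Finsupp.single e.1 1 - Finsupp.single e.2 1 : ι →₀ K)) '' A)) :
    ∃ e ∈ A, (e.1 = i ∨ e.2 = i) ∧ e.1 ≠ e.2 := by
  classical
  by_contra! hc
  have hle : Submodule.span K
      ((fun e : ι × ι => (Finsupp.single e.1 1 - Finsupp.single e.2 1 : ι →₀ K)) '' A) ≤
      LinearMap.ker (Finsupp.lapply i : (ι →₀ K) →ₗ[K] K) := by
    rw [Submodule.span_le]
    rintro _ ⟨e, he, rfl⟩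
    rw [SetLike.mem_coe, LinearMap.mem_ker, Finsupp.lapply_apply]
    by_cases h1 : e.1 = i ∨ e.2 = i
    · simp [hc e he h1]
    · push Not at h1
      simp [h1.1.symm, h1.2.symm]
  have := hle h
  rw [LinearMap.mem_ker, Finsupp.lapply_apply] at this
  simp [hij] at this

lemma tr_of_edges {ι σ : Type*} (m : ι → σ →₀ ℕ) (N : ℕ) :
    ∀ (V : Finset ι) (E : Finset (ι × ι)), V.card = N + 1 → E.card ≤ N →
    (∀ e ∈ E, e.1 ∈ V ∧ e.2 ∈ V) →
    (∀ i ∈ V, ∀ j ∈ V, (Finsupp.single i 1 - Finsupp.single j 1 : ι →₀ K) ∈ Submodule.span K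
      ((fun e : ι × ι => (Finsupp.single e.1 1 - Finsupp.single e.2 1 : ι →₀ K)) ''
        {e | e ∈ E ∧ m e.1 ⊔ m e.2 ≤ m i ⊔ m j})) →
    ∃ L, Tr L ∧ ∀ x, x ∈ L ↔ ∃ i ∈ V, m i = x := by
  classical
  induction N with
  | zero =>
    intro V E hV _ _ _
    obtain ⟨i, rfl⟩ := Finset.card_eq_one.1 hV
    exact ⟨[m i], Tr.single _, by simp [eq_comm]⟩
  | succ N ih =>
    intro V E hV hE hEV hspan
    have hcount : ∃ v ∈ V, (E.filter (fun e => e.1 = v ∨ e.2 = v)).card ≤ 1 := by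
      by_contra! hc
      have h1 : E.card = ∑ v ∈ V, (E.filter (fun e => e.1 = v)).card :=
        Finset.card_eq_sum_card_fiberwise (fun e he => (hEV e he).1)
      have h2 : E.card = ∑ v ∈ V, (E.filter (fun e => e.2 = v)).card :=
        Finset.card_eq_sum_card_fiberwise (fun e he => (hEV e he).2)
      have h3 : ∑ v ∈ V, 2 ≤ ∑ v ∈ V, ((E.filter (fun e => e.1 = v)).card +
          (E.filter (fun e => e.2 = v)).card) := by
        apply Finset.sum_le_sum
        intro v hv
        have h4 := hc v hv
        rw [Finset.filter_or] at h4
        have h5 := Finset.card_union_le (E.filter (fun e => e.1 = v)) (E.filter (fun e => e.2 = v))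
        omega
      rw [Finset.sum_add_distrib, ← h1, ← h2, Finset.sum_const, smul_eq_mul] at h3
      omega
    obtain ⟨v, hv, hcard⟩ := hcount
    obtain ⟨z, hz, hzv⟩ : ∃ z ∈ V, z ≠ v :=
      Finset.exists_mem_ne (by omega) v
    obtain ⟨e, ⟨he, _⟩, hev, hene⟩ := touch hzv.symm (hspan v hv z hz)
    have huniq : ∀ e' ∈ E, (e'.1 = v ∨ e'.2 = v) → e' = e := by
      intro e' he' h
      exact Finset.card_le_one.1 hcard e' (Finset.mem_filter.2 ⟨he', h⟩) e
        (Finset.mem_filter.2 ⟨he, hev⟩)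
    obtain ⟨w, hwV, hwv, hew, hle⟩ : ∃ w ∈ V, w ≠ v ∧ (e = (v, w) ∨ e = (w, v)) ∧
        m w ≤ m e.1 ⊔ m e.2 := by
      rcases hev with h | h
      · exact ⟨e.2, (hEV e he).2, by rw [← h]; exact hene.symm, Or.inl (by rw [← h]), le_sup_right⟩
      · exact ⟨e.1, (hEV e he).1, by rw [← h]; exact hene, Or.inr (by rw [← h]), le_sup_left⟩
    have hleaf : ∀ i ∈ V, i ≠ v → m w ≤ m v ⊔ m i := by
      intro i hi hiv
      obtain ⟨e', ⟨he', hle'⟩, hev', _⟩ := touch hiv.symm (hspan v hv i hi)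
      rw [huniq e' he' hev'] at hle'
      exact hle.trans hle'
    let π : (ι →₀ K) →ₗ[K] (ι →₀ K) :=
      Finsupp.linearCombination K (fun i => if i = v then Finsupp.single w 1 else Finsupp.single i 1)
    have hπ : ∀ i, i ≠ v → π (Finsupp.single i 1) = Finsupp.single i 1 := by
      intro i hi
      simp [π, hi]
    have hπv : π (Finsupp.single v 1) = Finsupp.single w 1 := by
      simp [π]
    obtain ⟨L, hL, hmem⟩ := ih (V.erase v) (E.erase e)
      (by rw [Finset.card_erase_of_mem hv]; omega)
      (by rw [Finset.card_erase_of_mem he]; omega)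
      (by
        intro e' he'
        obtain ⟨hne, he'⟩ := Finset.mem_erase.1 he'
        refine ⟨Finset.mem_erase.2 ⟨fun h => hne (huniq e' he' (Or.inl h)), (hEV e' he').1⟩,
          Finset.mem_erase.2 ⟨fun h => hne (huniq e' he' (Or.inr h)), (hEV e' he').2⟩⟩)
      (by
        intro i hi j hj
        obtain ⟨hiv, hi⟩ := Finset.mem_erase.1 hi
        obtain ⟨hjv, hj⟩ := Finset.mem_erase.1 hj
        have h := Submodule.mem_map_of_mem (f := π) (hspan i hi j hj)
        rw [map_sub, hπ i hiv, hπ j hjv, Submodule.map_span] at h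
        refine Submodule.span_le.2 ?_ h
        rintro _ ⟨_, ⟨e', ⟨he', hle'⟩, rfl⟩, rfl⟩
        by_cases hee : e' = e
        · have : π (Finsupp.single e'.1 1 - Finsupp.single e'.2 1) = 0 := by
            rw [map_sub, hee]
            rcases hew with h | h <;> rw [h] <;> simp only [hπv, hπ w hwv, sub_self]
          simp only [this, SetLike.mem_coe, Submodule.zero_mem]
        · have : π (Finsupp.single e'.1 1 - Finsupp.single e'.2 1) =
              Finsupp.single e'.1 1 - Finsupp.single e'.2 1 := by
            rw [map_sub, hπ _ (fun h => hee (huniq e' he' (Or.inl h))),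
              hπ _ (fun h => hee (huniq e' he' (Or.inr h)))]
          simp only [this]
          exact Submodule.subset_span ⟨e', ⟨Finset.mem_erase.2 ⟨hee, he'⟩, hle'⟩, rfl⟩)
    refine ⟨m v :: L, Tr.cons (m v) L (m w) ((hmem _).2 ⟨w, Finset.mem_erase.2 ⟨hwv, hwV⟩, rfl⟩)
      ?_ hL, ?_⟩
    · intro x hx
      obtain ⟨i, hi, rfl⟩ := (hmem _).1 hx
      obtain ⟨hiv, hi⟩ := Finset.mem_erase.1 hi
      exact hleaf i hi hiv
    · intro x
      rw [List.mem_cons, hmem]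
      constructor
      · rintro (rfl | ⟨i, hi, rfl⟩)
        · exact ⟨v, hv, rfl⟩
        · exact ⟨i, Finset.mem_of_mem_erase hi, rfl⟩
      · rintro ⟨i, hi, rfl⟩
        by_cases hiv : i = v
        · left; rw [hiv]
        · exact Or.inr ⟨i, Finset.mem_erase.2 ⟨hiv, hi⟩, rfl⟩

end comb

section Syz
open RingTheory.Sequence Function

universe u v

theorem syz_wr {R : Type*} [CommRing R] (y : R) (rs : List R) :
    ∀ {A B C : Type v} [AddCommGroup A] [AddCommGroup B] [AddCommGroup C]
      [Module R A] [Module R B] [Module R C] (f : A →ₗ[R] B) (g : B →ₗ[R] C),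
      Injective f → Exact f g → Surjective g → IsWeaklyRegular C rs →
      IsWeaklyRegular B (rs ++ [y]) → IsWeaklyRegular A (rs ++ [y]) := by
  induction rs with
  | nil =>
    intro A B C _ _ _ _ _ _ f g hf hfg hg hC hB
    simp only [List.nil_append, isWeaklyRegular_singleton_iff] at hB ⊢
    exact hB.of_injective f hf
  | cons r rs ih =>
    intro A B C _ _ _ _ _ _ f g hf hfg hg hC hB
    rw [List.cons_append, isWeaklyRegular_cons_iff] at hB ⊢
    rw [isWeaklyRegular_cons_iff] at hC
    refine ⟨hB.1.of_injective f hf, ih (QuotSMulTop.map r f) (QuotSMulTop.map r g) ?_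
      (QuotSMulTop.map_exact r hfg hg) (QuotSMulTop.map_surjective r hg) hC.2 hB.2⟩
    have h0 : Exact (0 : A →ₗ[R] A) f := by
      rw [LinearMap.exact_zero_iff_injective]; exact hf
    have := QuotSMulTop.map_first_exact_on_four_term_exact_of_isSMulRegular_last h0 hfg hC.1
    rw [map_zero] at this
    rwa [LinearMap.exact_zero_iff_injective] at this

theorem free_of_wr (k : ℕ) : ∀ (R : Type u) [CommRing R] [IsLocalRing R] [IsNoetherianRing R]
    (N : Type v) [AddCommGroup N] [Module R N] [Module.Finite R N] (rs : List R),
    rs.length = k → IsWeaklyRegular N rs → Ideal.ofList rs = IsLocalRing.maximalIdeal R →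
    Module.Free R N := by
  induction k with
  | zero =>
    intro R _ _ _ N _ _ _ rs hl hr hm
    rw [List.length_eq_zero_iff] at hl
    subst hl
    rw [Ideal.ofList_nil] at hm
    let _ := (IsLocalRing.isField_iff_maximalIdeal_eq.mpr hm.symm).toField
    exact Module.Free.of_divisionRing R N
  | succ k ih =>
    intro R _ _ _ N _ _ _ rs hl hr hm
    match rs, hl with
    | x :: rs, hl =>
      have hx : x ∈ IsLocalRing.maximalIdeal R := by
        rw [← hm]; exact Ideal.subset_span (by simp)
      rw [isWeaklyRegular_cons_iff'] at hr
      have hne : Ideal.span {x} ≠ ⊤ := by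
        intro h
        exact (IsLocalRing.maximalIdeal.isMaximal R).ne_top
          (top_le_iff.mp (h ▸ (Ideal.span_singleton_le_iff_mem _).mpr hx))
      have : Nontrivial (R ⧸ Ideal.span {x}) := Ideal.Quotient.nontrivial_iff.mpr hne
      have : IsLocalRing (R ⧸ Ideal.span {x}) :=
        IsLocalRing.of_surjective' (Ideal.Quotient.mk (Ideal.span {x}))
          Ideal.Quotient.mk_surjective
      have : Module.Finite (R ⧸ Ideal.span {x}) (QuotSMulTop x N) :=
        Module.Finite.of_restrictScalars_finite R _ _
      have hfree := ih (R ⧸ Ideal.span {x}) (QuotSMulTop x N)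
        (rs.map (Ideal.Quotient.mk (Ideal.span {x}))) (by simpa using hl) hr.2 (by
          rw [← Ideal.map_ofList]
          have h1 : (Ideal.ofList (x :: rs)).map (Ideal.Quotient.mk (Ideal.span {x})) =
            (Ideal.ofList rs).map (Ideal.Quotient.mk (Ideal.span {x})) := by
            rw [Ideal.ofList_cons, Ideal.map_sup, Ideal.map_quotient_self, bot_sup_eq]
          rw [← h1, hm]
          have := (IsLocalRing.maximalIdeal.isMaximal R)
          refine IsLocalRing.eq_maximalIdeal ((Ideal.map_eq_top_or_isMaximal_of_surjective _
            Ideal.Quotient.mk_surjective this).resolve_left ?_)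
          intro h
          have h2 := congrArg (Ideal.comap (Ideal.Quotient.mk (Ideal.span {x}))) h
          rw [Ideal.comap_map_of_surjective _ Ideal.Quotient.mk_surjective, Ideal.comap_top,
            ← RingHom.ker_eq_comap_bot, Ideal.mk_ker] at h2
          rw [sup_eq_left.mpr ((Ideal.span_singleton_le_iff_mem _).mpr hx)] at h2
          exact this.ne_top h2)
      have : Module.FinitePresentation R N := Module.finitePresentation_of_finite R N
      exact (Module.free_quotSMulTop_iff_free R N
        (IsLocalRing.maximalIdeal_le_jacobson _ hx) hr.1).mp hfree

open CategoryTheory in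
theorem pd_le (R : Type u) [CommRing R] [IsLocalRing R] [IsNoetherianRing R] (rs : List R)
    (hR : IsWeaklyRegular R rs) (hm : Ideal.ofList rs = IsLocalRing.maximalIdeal R) (k : ℕ) :
    ∀ (N : Type u) [AddCommGroup N] [Module R N] [Module.Finite R N] (i : ℕ),
      i + k = rs.length → IsWeaklyRegular N (rs.take i) →
      HasProjectiveDimensionLT (ModuleCat.of R N) (k + 1) := by
  induction k with
  | zero =>
    intro N _ _ _ i hi hr
    rw [List.take_of_length_le (by omega)] at hr
    have := free_of_wr _ R N rs rfl hr hm
    rw [zero_add, ← projective_iff_hasProjectiveDimensionLT_one, ← IsProjective.iff_projective]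
    infer_instance
  | succ k ih =>
    intro N _ _ _ i hi hr
    obtain ⟨P, _, _, _, _, f, hf⟩ := Module.exists_finite_presentation R N
    have hP : IsWeaklyRegular P rs :=
      ((TensorProduct.lid R P).isWeaklyRegular_congr rs).mp (hR.isWeaklyRegular_rTensor (M₂ := P))
    have hlt : i < rs.length := by omega
    have hP' : IsWeaklyRegular P (rs.take i ++ [rs[i]]) := by
      rw [List.take_append_getElem hlt]
      rw [← List.take_append_drop (i + 1) rs, isWeaklyRegular_append_iff] at hP
      exact hP.1
    have hK := syz_wr _ _ (LinearMap.ker f).subtype f (Submodule.subtype_injective _)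
      (LinearMap.exact_subtype_ker_map f) hf hr hP'
    have hih := ih (LinearMap.ker f) (i+1) (by omega) (by
      rw [← List.take_append_getElem hlt]; exact hK)
    have : Projective (ModuleCat.of R P) := by
      rw [← IsProjective.iff_projective]; infer_instance
    exact ((LinearMap.shortExact_shortComplexKer hf).hasProjectiveDimensionLT_X₃_iff _
      ‹_›).mpr hih

end Syz

section PD
open RingTheory.Sequence Function CategoryTheory

universe u

theorem pd_lt_three (R : Type u) [CommRing R] [IsLocalRing R] [IsNoetherianRing R] (xs : List R)
    (hR : IsWeaklyRegular R xs) (hm : Ideal.ofList xs = IsLocalRing.maximalIdeal R)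
    (M : Type u) [AddCommGroup M] [Module R M] [Module.Finite R M] [Nontrivial M] (rs : List R)
    (hr : IsWeaklyRegular M rs) (hrm : ∀ r ∈ rs, r ∈ IsLocalRing.maximalIdeal R)
    (hl : rs.length + 2 = xs.length) :
    HasProjectiveDimensionLT (ModuleCat.of R M) 3 := by
  have h1 := ModuleCat.projectiveDimension_quotient_eq_add_length_of_isWeaklyRegular
    (ModuleCat.of R M) rs hr hrm
  have h2 := pd_le R xs hR hm xs.length (M ⧸ Ideal.ofList rs • (⊤ : Submodule R M)) 0
    (by simp) (by simp)
  have h3 := (projectiveDimension_le_iff _ _).mpr h2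
  rw [h1, ← hl] at h3
  have h4 : projectiveDimension (ModuleCat.of R M) ≤ (2 : ℕ) := by
    rw [add_comm rs.length 2, Nat.cast_add] at h3
    exact (ENat.WithBot.add_le_add_natCast_right_iff).mp h3
  exact (projectiveDimension_le_iff _ _).mp h4

theorem ker_free (R : Type u) [CommRing R] [IsDomain R] [IsLocalRing R] [IsNoetherianRing R]
    (xs : List R)
    (hR : IsWeaklyRegular R xs) (hm : Ideal.ofList xs = IsLocalRing.maximalIdeal R)
    (J : Ideal R) (hJ0 : J ≠ ⊥) (hJ1 : J ≠ ⊤) (rs : List R)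
    (hr : IsWeaklyRegular (R ⧸ J) rs) (hrm : ∀ r ∈ rs, r ∈ IsLocalRing.maximalIdeal R)
    (hl : rs.length + 2 = xs.length) (r : ℕ) (φ : (Fin r → R) →ₗ[R] R)
    (hφ : LinearMap.range φ = J) :
    Module.Free R (LinearMap.ker φ) ∧ Module.finrank R (LinearMap.ker φ) + 1 ≤ r := by
  constructor
  · have : Nontrivial (R ⧸ J) := Ideal.Quotient.nontrivial_iff.mpr hJ1
    have h3 := pd_lt_three R xs hR hm (R ⧸ J) rs hr hrm hl
    have hsurj : Surjective J.mkQ := Submodule.mkQ_surjective J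
    have p1 : Projective (ModuleCat.of R R) := by
      rw [← IsProjective.iff_projective]; infer_instance
    have h2 := ((LinearMap.shortExact_shortComplexKer hsurj).hasProjectiveDimensionLT_X₃_iff 1
      p1).mp h3
    have h2' : HasProjectiveDimensionLT (ModuleCat.of R (LinearMap.ker J.mkQ)) 2 := h2
    rw [Submodule.ker_mkQ, ← hφ] at h2'
    have p2 : Projective (ModuleCat.of R (Fin r → R)) := by
      rw [← IsProjective.iff_projective]; infer_instance
    have h1 := ((LinearMap.shortExact_shortComplexKer
      φ.surjective_rangeRestrict).hasProjectiveDimensionLT_X₃_iff 0 p2).mp h2'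
    have h1' : HasProjectiveDimensionLT (ModuleCat.of R (LinearMap.ker φ.rangeRestrict)) 1 := h1
    rw [LinearMap.ker_rangeRestrict] at h1'
    rw [← projective_iff_hasProjectiveDimensionLT_one, ← IsProjective.iff_projective] at h1'
    exact Module.free_of_flat_of_isLocalRing
  · have h := Submodule.finrank_quotient_add_finrank (LinearMap.ker φ)
    rw [φ.quotKerEquivRange.finrank_eq] at h
    rw [Module.finrank_fin_fun] at h
    have : 0 < Module.finrank R (LinearMap.range φ) := by
      rw [hφ]
      have : Nontrivial J := Submodule.nontrivial_iff_ne_bot.mpr hJ0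
      exact Module.finrank_pos
    omega

end PD

section SyzygyModule

variable {K : Type*} [Field K] {σ : Type*}

/-- The pairwise syzygies. -/
noncomputable def sg (K : Type*) [Field K] {σ : Type*} {r : ℕ} (m : Fin r → σ →₀ ℕ)
    (e : Fin r × Fin r) : Fin r → MvPolynomial σ K :=
  Pi.single e.1 (monomial (m e.1 ⊔ m e.2 - m e.1) 1) -
    Pi.single e.2 (monomial (m e.1 ⊔ m e.2 - m e.2) 1)

lemma sg_mul {r : ℕ} (m : Fin r → σ →₀ ℕ) (i j : Fin r) (c : σ →₀ ℕ) (hi : m i ≤ c)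
    (hj : m j ≤ c) :
    (monomial (c - m i ⊔ m j) (1 : K)) • sg K m (i, j) =
      Pi.single i (monomial (c - m i) 1) - Pi.single j (monomial (c - m j) 1) := by
  have h : m i ⊔ m j ≤ c := sup_le hi hj
  have e1 : c - m i ⊔ m j + (m i ⊔ m j - m i) = c - m i := by
    ext x
    have := h x; have := hi x; have := hj x
    simp only [Finsupp.coe_add, Finsupp.coe_tsub, Pi.add_apply, Pi.sub_apply, Finsupp.sup_apply] at *
    omega
  have e2 : c - m i ⊔ m j + (m i ⊔ m j - m j) = c - m j := by
    ext x
    have := h x; have := hi x; have := hj x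
    simp only [Finsupp.coe_add, Finsupp.coe_tsub, Pi.add_apply, Pi.sub_apply, Finsupp.sup_apply] at *
    omega
  simp only [sg, smul_sub, ← Pi.single_smul, smul_eq_mul, monomial_mul, one_mul, e1, e2]

theorem syz_span {r : ℕ} (m : Fin r → σ →₀ ℕ) (q : Fin r → MvPolynomial σ K)
    (hq : ∑ i, q i * monomial (m i) 1 = 0) :
    q ∈ Submodule.span (MvPolynomial σ K) (Set.range (sg K m)) := by
  classical
  set W := Submodule.span (MvPolynomial σ K) (Set.range (sg K m)) with hW
  let u : (σ →₀ ℕ) → ((Fin r → MvPolynomial σ K) ⧸ W) := fun c =>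
    if h : ∃ i, m i ≤ c then
      W.mkQ (Pi.single h.choose (monomial (c - m h.choose) 1)) else 0
  have hu : ∀ i d, u (d + m i) = W.mkQ (Pi.single i (monomial d 1)) := by
    intro i d
    have h : ∃ j, m j ≤ d + m i := ⟨i, le_add_self⟩
    simp only [u, dif_pos h]
    rw [← sub_eq_zero, ← map_sub, Submodule.mkQ_apply, Submodule.Quotient.mk_eq_zero]
    have := sg_mul (K := K) m h.choose i (d + m i) h.choose_spec le_add_self
    rw [add_tsub_cancel_right] at this
    rw [← this]
    exact W.smul_mem _ (Submodule.subset_span ⟨_, rfl⟩)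
  let Ψ : MvPolynomial σ K →ₗ[K] ((Fin r → MvPolynomial σ K) ⧸ W) :=
    (basisMonomials σ K).constr K u
  have hΨ : ∀ c, Ψ (monomial c 1) = u c := by
    intro c
    have := (basisMonomials σ K).constr_basis K u c
    rwa [coe_basisMonomials] at this
  have key : ∀ i (p : MvPolynomial σ K), Ψ (p * monomial (m i) 1) = W.mkQ (Pi.single i p) := by
    intro i p
    induction p using MvPolynomial.induction_on' with
    | monomial d a =>
      have e : (monomial d a : MvPolynomial σ K) = a • monomial d 1 := by
        rw [smul_monomial, smul_eq_mul, mul_one]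
      rw [e, smul_mul_assoc, monomial_mul, one_mul, map_smul, hΨ, hu, Pi.single_smul]
      rfl
    | add p q hp hq => rw [add_mul, map_add, hp, hq, Pi.single_add, map_add]
  rw [← Submodule.Quotient.mk_eq_zero W, ← Submodule.mkQ_apply]
  rw [← Finset.univ_sum_single q, map_sum]
  simp_rw [← key]
  rw [← map_sum, hq, map_zero]

/-- Multigraded component. -/
noncomputable def Dc (K : Type*) [Field K] {σ : Type*} {r : ℕ} (m : Fin r → σ →₀ ℕ)
    (c : σ →₀ ℕ) : (Fin r → MvPolynomial σ K) →+ (Fin r →₀ K) := by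
  classical
  exact
  { toFun := fun q => Finsupp.equivFunOnFinite.symm
      (fun l => if m l ≤ c then coeff (c - m l) (q l) else 0)
    map_zero' := by ext l; simp
    map_add' := by
      intro p q
      ext l
      simp only [Finsupp.equivFunOnFinite_symm_apply_apply, Finsupp.add_apply, Pi.add_apply,
        coeff_add]
      split_ifs <;> simp }

lemma Dc_apply {r : ℕ} (m : Fin r → σ →₀ ℕ) (c : σ →₀ ℕ) (q : Fin r → MvPolynomial σ K)
    (l : Fin r) [Decidable (m l ≤ c)] :
    Dc K m c q l = if m l ≤ c then coeff (c - m l) (q l) else 0 := by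
  classical
  simp only [Dc, AddMonoidHom.coe_mk, ZeroHom.coe_mk, Finsupp.equivFunOnFinite_symm_apply_apply]
  congr

lemma Dc_single {r : ℕ} (m : Fin r → σ →₀ ℕ) (c t : σ →₀ ℕ) (k : Fin r) (hk : m k ≤ t)
    (g : MvPolynomial σ K) [Decidable (t ≤ c)] :
    Dc K m c (Pi.single k (g * monomial (t - m k) 1)) =
      if t ≤ c then coeff (c - t) g • Finsupp.single k 1 else 0 := by
  classical
  ext l
  rw [Dc_apply]
  by_cases hkl : l = k
  · subst hkl
    rw [Pi.single_eq_same]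
    by_cases htc : t ≤ c
    · rw [if_pos (hk.trans htc), if_pos htc, coeff_mul_monomial',
        if_pos (tsub_le_tsub_right htc _)]
      have : c - m l - (t - m l) = c - t := by
        ext x
        have := hk x; have := htc x
        simp only [Finsupp.coe_tsub, Pi.sub_apply]
        omega
      simp [this]
    · rw [if_neg htc]
      split_ifs with h
      · rw [coeff_mul_monomial', if_neg]
        · simp
        · intro h2
          apply htc
          intro x
          have := hk x; have := h x; have := h2 x
          simp only [Finsupp.coe_tsub, Pi.sub_apply] at this
          omega
      · simp
  · rw [Pi.single_eq_of_ne hkl]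
    split_ifs <;> simp [Ne.symm hkl]

lemma Dc_sg {r : ℕ} (m : Fin r → σ →₀ ℕ) (c : σ →₀ ℕ) (e : Fin r × Fin r)
    (g : MvPolynomial σ K) [Decidable (m e.1 ⊔ m e.2 ≤ c)] :
    Dc K m c (g • sg K m e) =
      if m e.1 ⊔ m e.2 ≤ c then coeff (c - (m e.1 ⊔ m e.2)) g •
        (Finsupp.single e.1 1 - Finsupp.single e.2 1) else 0 := by
  classical
  rw [sg, smul_sub, ← Pi.single_smul, ← Pi.single_smul, smul_eq_mul, smul_eq_mul, map_sub,
    Dc_single m c _ _ le_sup_left, Dc_single m c _ _ le_sup_right]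
  split_ifs
  · rw [smul_sub]
  · simp

theorem edge_span {r : ℕ} (m : Fin r → σ →₀ ℕ) {κ : Type*} [Fintype κ] (a : κ → Fin r × Fin r)
    (s : MvPolynomial σ K) (hs : coeff 0 s ≠ 0) (g : κ → MvPolynomial σ K) (i j : Fin r)
    (h : s • sg K m (i, j) = ∑ k, g k • sg K m (a k)) :
    (Finsupp.single i 1 - Finsupp.single j 1 : Fin r →₀ K) ∈ Submodule.span K
      ((fun e : Fin r × Fin r => (Finsupp.single e.1 1 - Finsupp.single e.2 1 : Fin r →₀ K)) ''
        {e | e ∈ Set.range a ∧ m e.1 ⊔ m e.2 ≤ m i ⊔ m j}) := by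
  classical
  have h1 := congrArg (Dc K m (m i ⊔ m j)) h
  rw [Dc_sg, if_pos le_rfl, tsub_self, map_sum] at h1
  rw [← Submodule.smul_mem_iff _ hs, h1]
  refine Submodule.sum_mem _ fun k _ => ?_
  rw [Dc_sg]
  split_ifs with hk
  · exact Submodule.smul_mem _ _ (Submodule.subset_span ⟨a k, ⟨⟨k, rfl⟩, hk⟩, rfl⟩)
  · exact Submodule.zero_mem _

end SyzygyModule

section Loc
open RingTheory.Sequence Function

universe u

variable {K : Type u} [Field K] {n : ℕ}

lemma mem_span_X_iff_single (s : Set (Fin n)) (i : Fin n) :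
    (X i : MvPolynomial (Fin n) K) ∈ Ideal.span (X '' s) ↔ i ∈ s := by
  rw [mem_ideal_span_X_image]
  classical
  rw [support_X]
  constructor
  · intro h
    obtain ⟨j, hj, hj2⟩ := h _ (Finset.mem_singleton_self _)
    have : j = i := by
      by_contra hne
      exact hj2 (by simp [Finsupp.single_apply, Ne.symm hne])
    exact this ▸ hj
  · intro h d hd
    rw [Finset.mem_singleton] at hd
    exact ⟨i, h, by simp [hd]⟩

lemma wr_X : IsWeaklyRegular (MvPolynomial (Fin n) K)
    (List.ofFn (X : Fin n → MvPolynomial (Fin n) K)) := by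
  constructor
  intro i hi
  rw [List.length_ofFn] at hi
  rw [List.getElem_ofFn]
  have h1 : (Ideal.ofList ((List.ofFn (X : Fin n → MvPolynomial (Fin n) K)).take i) •
      (⊤ : Submodule (MvPolynomial (Fin n) K) (MvPolynomial (Fin n) K))) =
      Ideal.span (X '' {j : Fin n | j.1 < i}) := by
    rw [smul_eq_mul, Ideal.mul_top, Ideal.ofList]
    congr 1
    ext p
    simp only [Set.mem_setOf_eq, List.mem_take_iff_getElem, List.getElem_ofFn, List.length_ofFn,
      Set.mem_image]
    constructor
    · rintro ⟨j, hj, rfl⟩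
      exact ⟨⟨j, by omega⟩, by simp; omega, rfl⟩
    · rintro ⟨j, hj, rfl⟩
      exact ⟨j.1, by simp; omega, rfl⟩
  rw [h1]
  have hp := prime_span_X (K := K) {j : Fin n | j.1 < i}
  have hx : (X ⟨i, hi⟩ : MvPolynomial (Fin n) K) ∉
      Ideal.span (X '' {j : Fin n | j.1 < i}) := by
    rw [mem_span_X_iff_single]; simp
  rw [isSMulRegular_iff_right_eq_zero_of_smul]
  intro y hy
  obtain ⟨y, rfl⟩ := Submodule.Quotient.mk_surjective _ y
  rw [← Submodule.Quotient.mk_smul, Submodule.Quotient.mk_eq_zero, smul_eq_mul] at hy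
  rw [Submodule.Quotient.mk_eq_zero]
  exact (hp.mem_or_mem hy).resolve_left hx

lemma ofList_X : Ideal.ofList (List.ofFn (X : Fin n → MvPolynomial (Fin n) K)) =
    Ideal.span (Set.range X) := by
  rw [Ideal.ofList]
  congr 1
  ext p
  simp [List.mem_ofFn]

lemma mem_maxX (p : MvPolynomial (Fin n) K) :
    p ∈ Ideal.span (Set.range (X : Fin n → MvPolynomial (Fin n) K)) ↔ coeff 0 p = 0 := by
  rw [← Set.image_univ, mem_ideal_span_X_image]
  constructor
  · intro h
    by_contra hc
    obtain ⟨i, _, hi⟩ := h 0 (mem_support_iff.mpr hc)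
    exact hi rfl
  · intro h d hd
    by_contra hc
    push Not at hc
    have : d = 0 := by ext i; exact hc i trivial
    rw [this, mem_support_iff] at hd
    exact hd h

theorem edges_exist {r : ℕ} (hr0 : 0 < r) (m : Fin r → Fin n →₀ ℕ)
    (hI : mI K (Set.range m) ≠ ⊤) (rs : List (MvPolynomial (Fin n) K))
    (hrs : IsWeaklyRegular (MvPolynomial (Fin n) K ⧸ mI K (Set.range m)) rs)
    (hrsm : ∀ x ∈ rs, x ∈ Ideal.span (Set.range (X : Fin n → MvPolynomial (Fin n) K)))
    (hl : rs.length + 2 = n) :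
    ∃ E : Finset (Fin r × Fin r), E.card + 1 ≤ r ∧ ∀ i j,
    (Finsupp.single i 1 - Finsupp.single j 1 : Fin r →₀ K) ∈ Submodule.span K
      ((fun e : Fin r × Fin r => (Finsupp.single e.1 1 - Finsupp.single e.2 1 : Fin r →₀ K)) ''
        {e | e ∈ E ∧ m e.1 ⊔ m e.2 ≤ m i ⊔ m j}) := by
  classical
  set 𝔪 := Ideal.span (Set.range (X : Fin n → MvPolynomial (Fin n) K)) with h𝔪
  have hmp : 𝔪.IsPrime := by
    have := prime_span_X (K := K) (Set.univ : Set (Fin n))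
    rwa [Set.image_univ] at this
  let R := Localization.AtPrime 𝔪
  let al := algebraMap (MvPolynomial (Fin n) K) R
  have hinj : Injective al :=
    IsLocalization.injective R 𝔪.primeCompl_le_nonZeroDivisors
  have : IsDomain R := IsLocalization.isDomain_of_le_nonZeroDivisors R 𝔪.primeCompl_le_nonZeroDivisors
  have : IsNoetherianRing R := IsLocalization.isNoetherianRing 𝔪.primeCompl R inferInstance
  set I := mI K (Set.range m) with hIdef
  set J := I.map al with hJ
  have hmax : 𝔪.map al = IsLocalRing.maximalIdeal R := Localization.AtPrime.map_eq_maximalIdeal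
  have hIm : I ≤ 𝔪 := by
    intro p hp
    rw [mem_maxX]
    by_contra hc
    obtain ⟨x, hx, hx0⟩ := mem_mI.mp hp 0 (mem_support_iff.mpr hc)
    apply hI
    rw [Ideal.eq_top_iff_one]
    exact monomial_mem_mI.mpr ⟨x, hx, hx0⟩
  have hJ1 : J ≠ ⊤ := by
    intro h
    have h2 : J ≤ IsLocalRing.maximalIdeal R := hmax ▸ Ideal.map_mono hIm
    rw [h, top_le_iff] at h2
    exact (IsLocalRing.maximalIdeal.isMaximal R).ne_top h2
  have hJ0 : J ≠ ⊥ := by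
    intro h
    have h1 : al (monomial (m ⟨0, hr0⟩) 1) ∈ J :=
      Ideal.mem_map_of_mem _ (monomial_mem_mI.mpr ⟨_, ⟨_, rfl⟩, le_rfl⟩)
    rw [h, Submodule.mem_bot] at h1
    have h2 := hinj (h1.trans (map_zero al).symm)
    rw [monomial_eq_zero] at h2
    exact one_ne_zero h2
  let φ : (Fin r → R) →ₗ[R] R := Fintype.linearCombination R (fun i => al (monomial (m i) 1))
  have hφr : LinearMap.range φ = J := by
    rw [Fintype.range_linearCombination, hJ, hIdef, mI, Ideal.map_span, ← Set.range_comp,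
      ← Set.range_comp]
    rfl
  have hrs' : IsWeaklyRegular (R ⧸ J) (rs.map al) := by
    have h1 := hrs.of_isLocalizedModule R 𝔪.primeCompl
      (Submodule.toLocalizedQuotient' R 𝔪.primeCompl (Algebra.linearMap _ R) I)
    rwa [Ideal.localized'_eq_map] at h1
  have hX : IsWeaklyRegular R ((List.ofFn (X : Fin n → MvPolynomial (Fin n) K)).map al) :=
    wr_X.of_isLocalization R 𝔪.primeCompl
  obtain ⟨hfree, hrank⟩ := ker_free R _ hX
    (by rw [← Ideal.map_ofList, ofList_X]; exact hmax) J hJ0 hJ1 (rs.map al) hrs'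
    (by
      intro x hx
      obtain ⟨y, hy, rfl⟩ := List.mem_map.mp hx
      rw [← hmax]
      exact Ideal.mem_map_of_mem _ (hrsm y hy)) (by simpa using hl) r φ hφr
  have hφ : ∀ q : Fin r → MvPolynomial (Fin n) K,
      φ (fun i => al (q i)) = al (∑ i, q i * monomial (m i) 1) := by
    intro q
    simp [φ, Fintype.linearCombination_apply]
  have hsgker : ∀ e : Fin r × Fin r, (fun i => al (sg K m e i)) ∈ LinearMap.ker φ := by
    intro e
    rw [LinearMap.mem_ker, hφ]
    have : ∑ i, sg K m e i * monomial (m i) 1 = 0 := by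
      simp only [sg, Pi.sub_apply, sub_mul, Finset.sum_sub_distrib, Pi.single_apply, ite_mul,
        zero_mul, Finset.sum_ite_eq', Finset.mem_univ, if_true, monomial_mul,
        one_mul]
      rw [tsub_add_cancel_of_le le_sup_left, tsub_add_cancel_of_le le_sup_right, sub_self]
    rw [this, map_zero]
  let v : Fin r × Fin r → LinearMap.ker φ := fun e => ⟨_, hsgker e⟩
  have hspan : Submodule.span R (Set.range v) = ⊤ := by
    rw [eq_top_iff]
    rintro ⟨w, hw⟩ -
    obtain ⟨s, hs⟩ := IsLocalization.exist_integer_multiples_of_finite 𝔪.primeCompl w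
    choose q hq using hs
    have hs' : ∀ i, al (q i) = al s * w i := by
      intro i
      rw [hq i, Algebra.smul_def]
    have hq0 : ∑ i, q i * monomial (m i) 1 = 0 := by
      apply hinj
      rw [← hφ, map_zero]
      have : (fun i => al (q i)) = al s • w := by ext i; exact hs' i
      rw [this, map_smul, LinearMap.mem_ker.mp hw, smul_zero]
    have hq1 := syz_span m q hq0
    have hunit : IsUnit (al s) := IsLocalization.map_units R s
    rw [Submodule.mem_span_range_iff_exists_fun] at hq1
    obtain ⟨c, hc⟩ := hq1
    rw [← Submodule.smul_mem_iff_of_isUnit _ hunit]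
    have : al s • (⟨w, hw⟩ : LinearMap.ker φ) = ∑ e, al (c e) • v e := by
      apply Subtype.ext
      ext i
      have := congrFun hc i
      simp only [Finset.sum_apply, Pi.smul_apply, smul_eq_mul] at this
      simp [v, ← hs', ← this, Finset.sum_apply]
    rw [this]
    exact Submodule.sum_mem _ fun e _ => Submodule.smul_mem _ _ (Submodule.subset_span ⟨e, rfl⟩)
  have := Module.finitePresentation_of_finite R (LinearMap.ker φ)
  obtain ⟨κ, a, b, hb⟩ := Module.exists_basis_of_span_of_flat v hspan
  have : Finite κ := Module.Finite.finite_basis b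
  have := Fintype.ofFinite κ
  refine ⟨Finset.univ.image a, ?_, ?_⟩
  · have h1 := Module.finrank_eq_card_basis b
    have h2 := Finset.card_image_le (s := Finset.univ) (f := a)
    rw [Finset.card_univ, ← h1] at h2
    omega
  · intro i j
    obtain ⟨s, hs⟩ := IsLocalization.exist_integer_multiples_of_finite 𝔪.primeCompl
      (fun k => b.repr (v (i, j)) k)
    choose g hg using hs
    have hsg : s.1 • sg K m (i, j) = ∑ k, g k • sg K m (a k) := by
      ext1 l
      apply hinj
      have h1 := congrArg (fun w : LinearMap.ker φ => w.1 l) (b.sum_repr (v (i, j)))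
      have hg' : ∀ k, al (g k) = al s * b.repr (v (i, j)) k := by
        intro k
        rw [hg k, Algebra.smul_def]
      simp [Finset.sum_apply, hg', hb, v] at h1 ⊢
      rw [← h1, Finset.mul_sum]
      exact Finset.sum_congr rfl fun k _ => by ring
    have := edge_span m a s.1 (by
      have := s.2
      rw [Ideal.mem_primeCompl_iff, mem_maxX] at this
      exact this) g i j hsg
    convert this using 5
    simp
end Loc

section Final
open RingTheory.Sequence Function

lemma dim_ge {K : Type*} [Field K] {n : ℕ} (G : Set (Fin n →₀ ℕ)) (i : Fin n)
    (h : ∀ g ∈ G, g i ≠ 0) :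
    ((n - 1 : ℕ) : WithBot ℕ∞) ≤ ringKrullDim (MvPolynomial (Fin n) K ⧸ mI K G) := by
  classical
  let f : MvPolynomial (Fin n) K →ₐ[K] MvPolynomial {j : Fin n // j ≠ i} K :=
    aeval (fun j => if hj : j ≠ i then X ⟨j, hj⟩ else 0)
  have hf : Surjective f := by
    intro p
    refine ⟨rename Subtype.val p, ?_⟩
    simp only [f, aeval_rename]
    have : ((fun j : Fin n => if hj : j ≠ i then (X ⟨j, hj⟩ : MvPolynomial {j : Fin n // j ≠ i} K)
        else 0) ∘ Subtype.val) = X := by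
      ext1 j
      simp [j.2]
    rw [this, aeval_X_left_apply]
  have hker : ∀ p ∈ mI K G, f.toRingHom p = 0 := by
    intro p hp
    have : mI K G ≤ RingHom.ker f.toRingHom := by
      rw [mI, Ideal.span_le]
      rintro _ ⟨g, hg, rfl⟩
      change f (monomial g 1) = 0
      simp only [f, aeval_monomial, map_one, one_mul]
      rw [Finsupp.prod]
      apply Finset.prod_eq_zero (i := i)
      · rw [Finsupp.mem_support_iff]; exact h g hg
      · simp [h g hg]
    exact this hp
  have h1 := ringKrullDim_le_of_surjective (Ideal.Quotient.lift _ f.toRingHom hker)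
    (Ideal.Quotient.lift_surjective_of_surjective _ _ hf)
  have h2 := ringKrullDim_add_natCard_le_ringKrullDim_mvPolynomial (R := K) {j : Fin n // j ≠ i}
  rw [ringKrullDim_eq_zero_of_field, zero_add] at h2
  have h3 : Nat.card {j : Fin n // j ≠ i} = n - 1 := by
    simp [Nat.card_eq_fintype_card, Fintype.card_subtype_compl]
  rw [h3] at h2
  exact h2.trans h1

lemma finite_gens {K : Type*} [Field K] {n : ℕ} {I : Ideal (MvPolynomial (Fin n) K)}
    (h : IsMonomialIdeal I) : ∃ F : Finset (Fin n →₀ ℕ), I = mI K (F : Set (Fin n →₀ ℕ)) := by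
  classical
  obtain ⟨G, rfl⟩ := h
  obtain ⟨s, hs, he⟩ := (Submodule.fg_span_iff_fg_span_finset_subset _).mp
    (IsNoetherian.noetherian (Ideal.span ((fun a : Fin n →₀ ℕ => (monomial a (1 : K))) '' G)))
  obtain ⟨F, hF, rfl⟩ := Finset.subset_set_image_iff.mp hs
  refine ⟨F, ?_⟩
  rw [mI]
  rw [Finset.coe_image] at he
  exact he

end Final

/-- Every Cohen–Macaulay monomial ideal of codimension (height) 2
is `0`-clean. -/
theorem cm_codim_two_zeroClean {K : Type*} [Field K] {n : ℕ}
    (I : Ideal (MvPolynomial (Fin n) K)) (hmon : IsMonomialIdeal I)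
    (hCM : IsCohenMacaulayQuot I)
    (hcodim : ringKrullDim (MvPolynomial (Fin n) K ⧸ I) + 2 = (n : WithBot ℕ∞)) :
    KClean K (Fin n) 0 I := by

  classical
  rw [← hCM] at hcodim
  have hd : depthQuot I + 2 = n := by exact_mod_cast hcodim
  have hItop : I ≠ ⊤ := by
    rintro rfl
    have : Subsingleton (MvPolynomial (Fin n) K ⧸ (⊤ : Ideal (MvPolynomial (Fin n) K))) :=
      Ideal.Quotient.subsingleton_iff.mpr rfl
    have h := hCM
    rw [IsCohenMacaulayQuot, ringKrullDim_eq_bot_of_subsingleton] at h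
    exact absurd h (by simp)
  obtain ⟨rs, hl, hrm, hr⟩ : ∃ rs : List (MvPolynomial (Fin n) K), rs.length + 2 = n ∧
      (∀ x ∈ rs, x ∈ Ideal.span (Set.range (X : Fin n → MvPolynomial (Fin n) K))) ∧
      RingTheory.Sequence.IsWeaklyRegular (MvPolynomial (Fin n) K ⧸ I) rs := by
    by_cases h0 : depthQuot I = 0
    · exact ⟨[], by simp; omega, by simp, by simp⟩
    · have hne : {r : ℕ | ∃ rs : List (MvPolynomial (Fin n) K), rs.length = r ∧
          (∀ x ∈ rs, x ∈ Ideal.span (Set.range (X : Fin n → MvPolynomial (Fin n) K))) ∧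
          RingTheory.Sequence.IsRegular (MvPolynomial (Fin n) K ⧸ I) rs}.Nonempty := by
        by_contra hc
        rw [Set.not_nonempty_iff_eq_empty] at hc
        apply h0
        rw [depthQuot, hc]
        simp
      have hb : BddAbove {r : ℕ | ∃ rs : List (MvPolynomial (Fin n) K), rs.length = r ∧
          (∀ x ∈ rs, x ∈ Ideal.span (Set.range (X : Fin n → MvPolynomial (Fin n) K))) ∧
          RingTheory.Sequence.IsRegular (MvPolynomial (Fin n) K ⧸ I) rs} := by
        by_contra hc
        exact h0 (Nat.sSup_of_not_bddAbove hc)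
      obtain ⟨rs, h1, h2, h3⟩ := Nat.sSup_mem hne hb
      refine ⟨rs, ?_, h2, h3.1⟩
      rw [h1]
      exact hd
  obtain ⟨F, hF⟩ := finite_gens hmon
  have hz : ∀ i, ∃ g ∈ F, g i = 0 := by
    intro i
    by_contra hc
    push Not at hc
    have h1 := dim_ge (K := K) (F : Set (Fin n →₀ ℕ)) i hc
    rw [← hF, ← hCM] at h1
    have h2 : n - 1 ≤ depthQuot I := by exact_mod_cast h1
    omega
  obtain ⟨g0, hg0, -⟩ := hz ⟨0, by omega⟩
  let m : Fin F.card → Fin n →₀ ℕ := fun i => (F.equivFin.symm i).1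
  have hm : ∀ x, x ∈ F ↔ ∃ i, m i = x := by
    intro x
    constructor
    · intro hx
      exact ⟨F.equivFin ⟨x, hx⟩, by simp [m]⟩
    · rintro ⟨i, rfl⟩
      exact (F.equivFin.symm i).2
  have hrange : (F : Set (Fin n →₀ ℕ)) = Set.range m := by
    ext x
    exact hm x
  rw [hrange] at hF
  have hpos : 0 < F.card := Finset.card_pos.mpr ⟨g0, hg0⟩
  subst hF
  obtain ⟨E, hE, hspan⟩ := edges_exist hpos m hItop rs hr hrm hl
  obtain ⟨L, hL, hLm⟩ := tr_of_edges (K := K) m (F.card - 1) Finset.univ E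
    (by rw [Finset.card_univ, Fintype.card_fin]; omega) (by omega) (by simp)
    (fun i _ j _ => hspan i j)
  have hset : {x | x ∈ L} = Set.range m := by
    ext x
    simp [hLm]
  rw [← hset] at hItop ⊢
  refine (good_tr _ L hL le_rfl hItop ?_).1
  intro i
  obtain ⟨g, hg, hgi⟩ := hz i
  obtain ⟨k, rfl⟩ := (hm g).mp hg
  exact ⟨_, (hLm _).mpr ⟨k, Finset.mem_univ _, rfl⟩, hgi⟩
end
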